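/- (Philippon's criterion) Let (𝕂, 𝒦, 𝒜, ℒ) be either (ℂ, ℚ, ℤ, a number field embedded in ℂ) with the usual absolute value, or (C, K = 𝔽_q(θ), A = 𝔽_q[θ], a finite extension of K embedded in C) with an absolute value associated to the 1/θ-adic valuation; let h be the corresponding absolute logarithmic height. Let (α_1, …, α_m) ∈ 𝕂^m and 1 ≤ k ≤ m. Suppose there exist increasing functions δ, σ, λ : ℤ_{≥1} → ℝ_{≥1} and positive reals c_2, c_3, c_δ, c_λ, c_σ such that: (1) δ(n) → ∞; (2) s(n+1)/s(n) → c_s for s = δ, σ, λ; (3) σ(n) ≥ δ(n) for n large; (4) n ↦ λ(n)/(δ(n)^{k+1} σ(n)) is ultimately increasing; (5) λ(n)^{k+1} > σ(n) δ(n)^{k-1} (λ(n)^k + δ(n)^k) for n large. Suppose there is a sequence of polynomials Q_n ∈ ℒ[X_1,…,X_m] with coefficients integral over 𝒜, deg_{X_i} Q_n ≤ δ(n) for all i, h(Q_n) ≤ σ(n), and −c_2 λ(n) < log|Q_n(α_1,…,α_m)| < −c_3 λ(n) for all n large. Then the transcendence degree over ℒ of ℒ(α_1,…,α_m) is at least k.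 -/

import Mathlib

set_option synthInstance.maxHeartbeats 400000
set_option maxHeartbeats 1000000

open Filter

/-- The transcendence degree over `R` of the intermediate field `R(S)`
generated by a subset `S` of a field extension `A` of `R`: the supremum of the
cardinalities of subsets of `R(S)` that are algebraically independent
over `R`. -/
noncomputable def genTrdeg (R A : Type*) [Field R] [Field A] [Algebra R A] (S : Set A) :
    Cardinal :=
  ⨆ s : { s : Set A //
      s ⊆ (IntermediateField.adjoin R S : Set A) ∧ AlgebraicIndependent R ((↑) : s → A) },
    Cardinal.mk s.1

/-- `c ∈ ℒ` is integral over the subring `𝒜 ⊆ 𝒦`: it is killed by a monic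
polynomial with coefficients in `𝒜`. -/
def IsIntegralOverSubring (𝒦 : Type*) [Field 𝒦] (𝒜 : Subring 𝒦)
    {𝕂 : Type*} [Field 𝕂] [Algebra 𝒦 𝕂] (ℒ : IntermediateField 𝒦 𝕂) (c : ℒ) : Prop :=
  ∃ p : Polynomial 𝒦, p.Monic ∧ (∀ i, p.coeff i ∈ 𝒜) ∧ Polynomial.aeval c p = 0

/-- The absolute logarithmic height of the projective point whose coordinates
are `1` and the coefficients of `Q ∈ ℒ[X_1,…,X_m]`.  For coefficients integral
over `𝒜` the finite places contribute nothing, and the height is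
`(1/[ℒ:𝒦]) ∑_{σ : ℒ → 𝕂} log max(1, max_i |σ(coeff_i)|)`, the sum running over
the `𝒦`-embeddings of `ℒ` in `𝕂`. -/
noncomputable def coeffProjHeight (𝒦 𝕂 : Type*) [Field 𝒦] [NormedField 𝕂] [Algebra 𝒦 𝕂]
    (ℒ : IntermediateField 𝒦 𝕂) {m : ℕ} (Q : MvPolynomial (Fin m) ℒ) : ℝ :=
  (Module.finrank 𝒦 ℒ : ℝ)⁻¹ *
    ∑ᶠ σ : ℒ →ₐ[𝒦] 𝕂,
      Real.log (max 1 ((Q.support.sup fun mo => ‖σ (Q.coeff mo)‖₊ : NNReal) : ℝ))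

/-- The statement of Philippon's criterion of algebraic independence for the
data `(𝕂, 𝒦, 𝒜, ℒ)` with height `coeffProjHeight`. -/
def PhilipponCriterion (𝒦 𝕂 : Type*) [Field 𝒦] [NormedField 𝕂] [Algebra 𝒦 𝕂]
    (𝒜 : Subring 𝒦) (ℒ : IntermediateField 𝒦 𝕂) : Prop :=
  ∀ (m k : ℕ), 1 ≤ k → k ≤ m →
  ∀ (α : Fin m → 𝕂) (δ σh lam : ℕ → ℝ) (c₂ c₃ cδ cσ clam : ℝ),
    0 < c₂ → 0 < c₃ → 0 < cδ → 0 < cσ → 0 < clam →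
    (∀ n, 1 ≤ δ n) → Monotone δ →
    (∀ n, 1 ≤ σh n) → Monotone σh →
    (∀ n, 1 ≤ lam n) → Monotone lam →
    -- (1) `δ(n) → ∞`
    Tendsto δ atTop atTop →
    -- (2) `s(n+1)/s(n) → c_s` for `s = δ, σ, λ`
    Tendsto (fun n => δ (n + 1) / δ n) atTop (nhds cδ) →
    Tendsto (fun n => σh (n + 1) / σh n) atTop (nhds cσ) →
    Tendsto (fun n => lam (n + 1) / lam n) atTop (nhds clam) →
    -- (3) `σ(n) ≥ δ(n)` for `n` large
    (∀ᶠ n in atTop, δ n ≤ σh n) →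
    -- (4) `n ↦ λ(n)/(δ(n)^{k+1} σ(n))` is ultimately increasing
    (∃ N₀ : ℕ, MonotoneOn (fun n => lam n / (δ n ^ (k + 1) * σh n)) (Set.Ici N₀)) →
    -- (5) `λ(n)^{k+1} > σ(n) δ(n)^{k-1} (λ(n)^k + δ(n)^k)` for `n` large
    (∀ᶠ n in atTop, σh n * δ n ^ (k - 1) * (lam n ^ k + δ n ^ k) < lam n ^ (k + 1)) →
    ∀ Q : ℕ → MvPolynomial (Fin m) ℒ,
      (∀ n mo, IsIntegralOverSubring 𝒦 𝒜 ℒ ((Q n).coeff mo)) →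
      (∀ n (i : Fin m), (((Q n).degreeOf i : ℕ) : ℝ) ≤ δ n) →
      (∀ n, coeffProjHeight 𝒦 𝕂 ℒ (Q n) ≤ σh n) →
      (∀ᶠ n in atTop,
        -c₂ * lam n <
            Real.log ‖MvPolynomial.eval α (MvPolynomial.map (algebraMap ℒ 𝕂) (Q n))‖ ∧
          Real.log ‖MvPolynomial.eval α (MvPolynomial.map (algebraMap ℒ 𝕂) (Q n))‖ <
            -c₃ * lam n) →
      (k : Cardinal) ≤ genTrdeg ℒ 𝕂 (Set.range α)

namespace PhilC

section PLen
variable {A : Type*} (𝕂 : Type*) [CommRing A] [NormedField 𝕂] [Algebra A 𝕂] {ι : Type*}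

/-- The length (sum of absolute values of the coefficients) of a polynomial. -/
noncomputable def plen (f : MvPolynomial ι A) : ℝ :=
  ∑ e ∈ f.support, ‖algebraMap A 𝕂 (f.coeff e)‖

lemma plen_eq_of_subset (f : MvPolynomial ι A) (s : Finset (ι →₀ ℕ)) (h : f.support ⊆ s) :
    plen 𝕂 f = ∑ e ∈ s, ‖algebraMap A 𝕂 (f.coeff e)‖ := by
  refine Finset.sum_subset h fun e _ he => ?_
  rw [MvPolynomial.notMem_support_iff.1 he]; simp

lemma plen_nonneg (f : MvPolynomial ι A) : 0 ≤ plen 𝕂 f :=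
  Finset.sum_nonneg fun _ _ => norm_nonneg _

lemma plen_zero : plen 𝕂 (0 : MvPolynomial ι A) = 0 := by simp [plen]

lemma plen_monomial (e : ι →₀ ℕ) (a : A) :
    plen 𝕂 (MvPolynomial.monomial e a) = ‖algebraMap A 𝕂 a‖ := by
  classical
  rw [plen_eq_of_subset 𝕂 _ {e} MvPolynomial.support_monomial_subset]
  simp

lemma plen_add (f g : MvPolynomial ι A) : plen 𝕂 (f + g) ≤ plen 𝕂 f + plen 𝕂 g := by
  classical
  rw [plen_eq_of_subset 𝕂 (f + g) (f.support ∪ g.support) MvPolynomial.support_add,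
    plen_eq_of_subset 𝕂 f (f.support ∪ g.support) Finset.subset_union_left,
    plen_eq_of_subset 𝕂 g (f.support ∪ g.support) Finset.subset_union_right,
    ← Finset.sum_add_distrib]
  refine Finset.sum_le_sum fun e _ => ?_
  rw [MvPolynomial.coeff_add, map_add]
  exact norm_add_le _ _

lemma plen_sum {κ : Type*} (s : Finset κ) (f : κ → MvPolynomial ι A) :
    plen 𝕂 (∑ i ∈ s, f i) ≤ ∑ i ∈ s, plen 𝕂 (f i) := by
  classical
  induction s using Finset.induction_on with
  | empty => simp [plen_zero]
  | insert a s ha ih =>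
    rw [Finset.sum_insert ha, Finset.sum_insert ha]
    exact (plen_add 𝕂 _ _).trans (by linarith)

lemma plen_mul (f g : MvPolynomial ι A) : plen 𝕂 (f * g) ≤ plen 𝕂 f * plen 𝕂 g := by
  classical
  have h : f * g = ∑ e ∈ f.support, ∑ e' ∈ g.support,
      MvPolynomial.monomial (e + e') (f.coeff e * g.coeff e') := by
    conv_lhs => rw [f.as_sum, g.as_sum]
    rw [Finset.sum_mul_sum]
    simp [MvPolynomial.monomial_mul]
  rw [h]
  refine (plen_sum 𝕂 _ _).trans ?_
  rw [plen, plen, Finset.sum_mul_sum]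
  refine Finset.sum_le_sum fun e _ => (plen_sum 𝕂 _ _).trans (Finset.sum_le_sum fun e' _ => ?_)
  rw [plen_monomial, map_mul, norm_mul]

lemma norm_coeff_le_plen (f : MvPolynomial ι A) (e : ι →₀ ℕ) :
    ‖algebraMap A 𝕂 (f.coeff e)‖ ≤ plen 𝕂 f := by
  by_cases he : e ∈ f.support
  · exact Finset.single_le_sum (f := fun e => ‖algebraMap A 𝕂 (f.coeff e)‖)
      (fun _ _ => norm_nonneg _) he
  · rw [MvPolynomial.notMem_support_iff.1 he]; simpa using plen_nonneg 𝕂 f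

end PLen

section Rep
variable {A 𝕂 : Type*} [CommRing A] [NormedField 𝕂] [Algebra A 𝕂] {ι κ : Type*} [Fintype κ]

/-- `z` acts on the vector `g` through a matrix of polynomials in `x` of degree at most `N` and
length at most `Λ / card κ`. -/
def Rep (A : Type*) {𝕂 : Type*} [CommRing A] [NormedField 𝕂] [Algebra A 𝕂] {ι κ : Type*}
    [Fintype κ] (x : ι → 𝕂) (g : κ → 𝕂) (z : 𝕂) (N : ℕ) (Λ : ℝ) : Prop :=
  ∃ T : κ → κ → MvPolynomial ι A,
    (∀ i, z * g i = ∑ j, MvPolynomial.aeval x (T i j) * g j) ∧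
    (∀ i j, (T i j).totalDegree ≤ N) ∧
    (∀ i j, Fintype.card κ * plen 𝕂 (T i j) ≤ Λ)

variable {x : ι → 𝕂} {g : κ → 𝕂}

lemma Rep.mono {z : 𝕂} {N N' : ℕ} {Λ Λ' : ℝ} (h : Rep A x g z N Λ) (hN : N ≤ N') (hΛ : Λ ≤ Λ') :
    Rep A x g z N' Λ' := by
  obtain ⟨T, h1, h2, h3⟩ := h
  exact ⟨T, h1, fun i j => (h2 i j).trans hN, fun i j => (h3 i j).trans hΛ⟩

lemma Rep.mul {z z' : 𝕂} {N N' : ℕ} {Λ Λ' : ℝ} (h : Rep A x g z N Λ) (h' : Rep A x g z' N' Λ')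
    : Rep A x g (z * z') (N + N') (Λ * Λ') := by
  obtain ⟨T, h1, h2, h3⟩ := h
  obtain ⟨T', h1', h2', h3'⟩ := h'
  refine ⟨fun i j => ∑ l, T' i l * T l j, fun i => ?_, fun i j => ?_, fun i j => ?_⟩
  · rw [mul_assoc, h1' i, Finset.mul_sum]
    simp_rw [map_sum, Finset.sum_mul, map_mul]
    rw [Finset.sum_comm]
    refine Finset.sum_congr rfl fun l _ => ?_
    rw [mul_left_comm, h1 l, Finset.mul_sum]
    simp_rw [mul_assoc]
  · refine MvPolynomial.totalDegree_finsetSum_le fun l _ => ?_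
    refine (MvPolynomial.totalDegree_mul _ _).trans ?_
    have := h2 l j
    have := h2' i l
    omega
  · have hc : (0 : ℝ) ≤ Fintype.card κ := Nat.cast_nonneg _
    calc Fintype.card κ * plen 𝕂 (∑ l, T' i l * T l j)
        ≤ Fintype.card κ * ∑ l, plen 𝕂 (T' i l) * plen 𝕂 (T l j) := by
          gcongr
          exact (plen_sum 𝕂 _ _).trans (Finset.sum_le_sum fun l _ => plen_mul 𝕂 _ _)
      _ = ∑ l, plen 𝕂 (T' i l) * (Fintype.card κ * plen 𝕂 (T l j)) := by
          rw [Finset.mul_sum]; exact Finset.sum_congr rfl fun l _ => by ring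
      _ ≤ ∑ l, plen 𝕂 (T' i l) * Λ :=
          Finset.sum_le_sum fun l _ => mul_le_mul_of_nonneg_left (h3 l j) (plen_nonneg _ _)
      _ = (∑ l, plen 𝕂 (T' i l)) * Λ := by rw [Finset.sum_mul]
      _ ≤ Λ' * Λ := by
          have hΛ : 0 ≤ Λ := le_trans (mul_nonneg hc (plen_nonneg _ _)) (h3 i i)
          refine mul_le_mul_of_nonneg_right ?_ hΛ
          have : Nonempty κ := ⟨i⟩
          have hcp : (0 : ℝ) < Fintype.card κ := by exact_mod_cast Fintype.card_pos
          have : ∀ l, plen 𝕂 (T' i l) ≤ Λ' / Fintype.card κ := fun l => by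
            rw [le_div_iff₀ hcp, mul_comm]; exact h3' i l
          refine (Finset.sum_le_sum fun l _ => this l).trans ?_
          simp; field_simp; exact le_rfl
      _ = Λ * Λ' := mul_comm _ _

lemma Rep.add {z z' : 𝕂} {N : ℕ} {Λ Λ' : ℝ} (h : Rep A x g z N Λ) (h' : Rep A x g z' N Λ')
    : Rep A x g (z + z') N (Λ + Λ') := by
  obtain ⟨T, h1, h2, h3⟩ := h
  obtain ⟨T', h1', h2', h3'⟩ := h'
  refine ⟨fun i j => T i j + T' i j, fun i => ?_, fun i j => ?_, fun i j => ?_⟩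
  · rw [add_mul, h1, h1', ← Finset.sum_add_distrib]
    exact Finset.sum_congr rfl fun j _ => by rw [map_add, add_mul]
  · exact (MvPolynomial.totalDegree_add _ _).trans (max_le (h2 i j) (h2' i j))
  · have := plen_add 𝕂 (T i j) (T' i j)
    have := mul_le_mul_of_nonneg_left this (Nat.cast_nonneg (α := ℝ) (Fintype.card κ))
    have := h3 i j
    have := h3' i j
    linarith

lemma Rep.zero (N : ℕ) : Rep A x g 0 N 0 :=
  ⟨fun _ _ => 0, by simp, by simp, by simp [plen_zero]⟩

lemma Rep.sum {τ : Type*} (s : Finset τ) {z : τ → 𝕂} {N : ℕ} {Λ : τ → ℝ}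
    (h : ∀ i ∈ s, Rep A x g (z i) N (Λ i)) : Rep A x g (∑ i ∈ s, z i) N (∑ i ∈ s, Λ i) := by
  classical
  induction s using Finset.induction_on with
  | empty => simpa using Rep.zero N
  | insert a s ha ih =>
    rw [Finset.sum_insert ha, Finset.sum_insert ha]
    exact (h a (Finset.mem_insert_self _ _)).add
      (ih fun i hi => h i (Finset.mem_insert_of_mem hi))

/-- Elements of `A[x]` act through scalar matrices. -/
lemma Rep.poly (f : MvPolynomial ι A) :
    Rep A x g (MvPolynomial.aeval x f) f.totalDegree (Fintype.card κ * plen 𝕂 f) := by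
  classical
  refine ⟨fun i j => if i = j then f else 0, fun i => ?_, fun i j => ?_, fun i j => ?_⟩
  · rw [Finset.sum_eq_single i]
    · simp
    · intro j _ hj; simp [hj.symm]
    · simp
  · dsimp only; split_ifs <;> simp
  · dsimp only; split_ifs
    · exact le_rfl
    · rw [plen_zero, mul_zero]; exact mul_nonneg (Nat.cast_nonneg _) (plen_nonneg _ _)

lemma Rep.one : Rep A x g 1 0 (Fintype.card κ) := by
  have := Rep.poly (x := x) (g := g) (MvPolynomial.C (1 : A))
  have h : plen 𝕂 (MvPolynomial.C (1 : A) : MvPolynomial ι A) = 1 := by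
    rw [← MvPolynomial.monomial_zero', plen_monomial]; simp
  rw [h] at this
  simpa using this

lemma Rep.smul {z : 𝕂} {N : ℕ} {Λ : ℝ} (h : Rep A x g z N Λ) (a : A) :
    Rep A x g (algebraMap A 𝕂 a * z) N (‖algebraMap A 𝕂 a‖ * Λ) := by
  obtain ⟨T, h1, h2, h3⟩ := h
  refine ⟨fun i j => MvPolynomial.C a * T i j, fun i => ?_, fun i j => ?_, fun i j => ?_⟩
  · rw [mul_assoc, h1, Finset.mul_sum]
    exact Finset.sum_congr rfl fun j _ => by simp [mul_assoc]
  · refine (MvPolynomial.totalDegree_mul _ _).trans ?_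
    simpa using h2 i j
  · have h : plen 𝕂 (MvPolynomial.C a : MvPolynomial ι A) = ‖algebraMap A 𝕂 a‖ := by
      rw [← MvPolynomial.monomial_zero', plen_monomial]
    have h4 := plen_mul 𝕂 (MvPolynomial.C a) (T i j)
    rw [h] at h4
    calc _ ≤ Fintype.card κ * (‖algebraMap A 𝕂 a‖ * plen 𝕂 (T i j)) := by gcongr
      _ = ‖algebraMap A 𝕂 a‖ * (Fintype.card κ * plen 𝕂 (T i j)) := by ring
      _ ≤ _ := mul_le_mul_of_nonneg_left (h3 i j) (norm_nonneg _)

lemma Rep.pow {z : 𝕂} {N : ℕ} {Λ : ℝ} (h : Rep A x g z N Λ) (n : ℕ) :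
    Rep A x g (z ^ n) (n * N) (Fintype.card κ * Λ ^ n) := by
  induction n with
  | zero => simpa using Rep.one
  | succ n ih =>
    rw [pow_succ, pow_succ, ← mul_assoc]
    exact (ih.mul h).mono (by rw [Nat.succ_mul]) le_rfl

end Rep

end PhilC

namespace PhilC

section RepEx
variable {A 𝕂 : Type*} [CommRing A] [NormedField 𝕂] [Algebra A 𝕂] {ι : Type*}

lemma exists_trans_basis [IsDomain A] [FaithfulSMul A 𝕂] {m : ℕ} (α : Fin m → 𝕂) :
    ∃ u : Set 𝕂, u ⊆ Set.range α ∧ AlgebraicIndependent A ((↑) : u → 𝕂) ∧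
      ∀ i, IsAlgebraic (Algebra.adjoin A (Set.range ((↑) : u → 𝕂))) (α i) := by
  obtain ⟨u, hu⟩ := (AlgebraicIndependent.matroid A 𝕂).exists_isBasis (Set.range α)
    (by simp)
  rw [AlgebraicIndependent.matroid_isBasis_iff] at hu
  refine ⟨u, hu.2.1, hu.1, fun i => ?_⟩
  rw [Subtype.range_coe]
  exact hu.2.2 _ ⟨i, rfl⟩

lemma Rep.exists_of_sum {κ : Type*} [Fintype κ] {x : ι → 𝕂} {g : κ → 𝕂} {z : 𝕂}
    (h : ∀ i, ∃ c : κ → MvPolynomial ι A, z * g i = ∑ j, MvPolynomial.aeval x (c j) * g j) :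
    ∃ N Λ, Rep A x g z N Λ := by
  classical
  choose T hT using h
  refine ⟨∑ i, ∑ j, (T i j).totalDegree, ∑ i, ∑ j, Fintype.card κ * plen 𝕂 (T i j), T, hT,
    fun i j => ?_, fun i j => ?_⟩
  · refine le_trans ?_ (Finset.single_le_sum (f := fun i => ∑ j, (T i j).totalDegree)
      (fun _ _ => Nat.zero_le _) (Finset.mem_univ i))
    exact Finset.single_le_sum (f := fun j => (T i j).totalDegree)
      (fun _ _ => Nat.zero_le _) (Finset.mem_univ j)
  · have h0 : ∀ i j, 0 ≤ Fintype.card κ * plen 𝕂 (T i j) :=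
      fun i j => mul_nonneg (Nat.cast_nonneg _) (plen_nonneg _ _)
    refine le_trans ?_ (Finset.single_le_sum (f := fun i => ∑ j, Fintype.card κ * plen 𝕂 (T i j))
      (fun i _ => Finset.sum_nonneg fun j _ => h0 i j) (Finset.mem_univ i))
    exact Finset.single_le_sum (f := fun j => Fintype.card κ * plen 𝕂 (T i j))
      (fun j _ => h0 i j) (Finset.mem_univ j)

lemma exists_rep {κ' : Type*} [Fintype κ'] [IsDomain A] (x : ι → 𝕂)
    (w : κ' → 𝕂) (hw : ∀ i, IsAlgebraic (Algebra.adjoin A (Set.range x)) (w i)) :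
    ∃ (D : ℕ) (g : Fin D → 𝕂) (b : MvPolynomial ι A), MvPolynomial.aeval x b ≠ 0 ∧
      (∃ j, g j ≠ 0) ∧
      ∃ N Λ, ∀ i, Rep A x g (MvPolynomial.aeval x b * w i) N Λ := by
  classical
  have hmem : ∀ r : Algebra.adjoin A (Set.range x), ∃ f : MvPolynomial ι A,
      MvPolynomial.aeval x f = (r : 𝕂) := fun r => by
    have h1 : (r : 𝕂) ∈ (MvPolynomial.aeval (R := A) x).range :=
      (Algebra.adjoin_range_eq_range_aeval A x) ▸ r.2
    exact h1
  choose y hy0 hy using fun i => (hw i).exists_integral_multiple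
  set Y := ∏ i, y i with hY
  have hY0 : Y ≠ 0 := Finset.prod_ne_zero_iff.2 fun i _ => hy0 i
  have hint : ∀ i, IsIntegral (Algebra.adjoin A (Set.range x)) (Y • w i) := fun i => by
    rw [hY, ← Finset.prod_erase_mul _ _ (Finset.mem_univ i), mul_smul]
    exact (hy i).smul _
  have hfg := fg_adjoin_of_finite (R := Algebra.adjoin A (Set.range x))
    (s := Set.range fun i => Y • w i) (Set.finite_range _) (by rintro _ ⟨i, rfl⟩; exact hint i)
  obtain ⟨D, g, hg⟩ := Submodule.fg_iff_exists_fin_generating_family.1 hfg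
  obtain ⟨b, hb⟩ := hmem Y
  have hspan : ∀ z : 𝕂, z ∈ Submodule.span (Algebra.adjoin A (Set.range x)) (Set.range g) ↔
      z ∈ Algebra.adjoin (Algebra.adjoin A (Set.range x)) (Set.range fun i => Y • w i) := by
    intro z; rw [hg]; rfl
  have hrep : ∀ i, ∃ N Λ, Rep A x g (MvPolynomial.aeval x b * w i) N Λ := by
    intro i
    apply Rep.exists_of_sum
    intro j
    have h1 : (Y • w i) * g j ∈ Algebra.adjoin (Algebra.adjoin A (Set.range x))
        (Set.range fun i => Y • w i) :=
      mul_mem (Algebra.subset_adjoin ⟨i, rfl⟩)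
        ((hspan _).1 (Submodule.subset_span ⟨j, rfl⟩))
    rw [← hspan, Submodule.mem_span_range_iff_exists_fun] at h1
    obtain ⟨c, hc⟩ := h1
    choose f hf using fun l => hmem (c l)
    refine ⟨f, ?_⟩
    rw [hb]
    have : (Y : 𝕂) * w i * g j = (Y • w i) * g j := rfl
    rw [this, ← hc]
    exact Finset.sum_congr rfl fun l _ => by rw [hf]; rfl
  choose N Λ hN using hrep
  refine ⟨D, g, b, ?_, ?_, ∑ i, N i, ∑ i, |Λ i|, fun i => (hN i).mono ?_ ?_⟩
  · rw [hb]; exact_mod_cast hY0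
  · by_contra hcon
    push Not at hcon
    have h1 := (hspan 1).2 (one_mem _)
    rw [Submodule.mem_span_range_iff_exists_fun] at h1
    obtain ⟨c, hc⟩ := h1
    simp [hcon] at hc
  · exact Finset.single_le_sum (f := N) (fun _ _ => Nat.zero_le _) (Finset.mem_univ i)
  · exact (le_abs_self _).trans (Finset.single_le_sum (f := fun i => |Λ i|)
      (fun _ _ => abs_nonneg _) (Finset.mem_univ i))

lemma Rep.list_prod {κ : Type*} [Fintype κ] {x : ι → 𝕂} {g : κ → 𝕂} (Z : ℕ → 𝕂) (N : ℕ)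
    (Λ : ℝ) (hΛ : 1 ≤ Λ) (l : List ℕ) (r : ℕ) (hl : l.length ≤ r)
    (h : ∀ j ∈ l, Rep A x g (Z j) N Λ) :
    Rep A x g (l.map Z).prod (r * N) (Fintype.card κ * Λ ^ r) := by
  have key : Rep A x g (l.map Z).prod (l.length * N) (Fintype.card κ * Λ ^ l.length) := by
    clear hl
    induction l with
    | nil => simpa using Rep.one
    | cons a l ih =>
      have h1 := (h a (by simp)).mul (ih fun j hj => h j (by simp [hj]))
      simp only [List.map_cons, List.prod_cons, List.length_cons]
      refine h1.mono (by ring_nf; rfl) ?_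
      rw [pow_succ]; apply le_of_eq; ring
  refine key.mono (Nat.mul_le_mul_right _ hl) ?_
  gcongr

end RepEx

end PhilC

namespace PhilC

section Coef

lemma exists_coef (A 𝒦 𝕂 : Type*) [CommRing A] [IsDomain A] [IsIntegrallyClosed A] [Field 𝒦]
    [NormedField 𝕂]
    [IsAlgClosed 𝕂] [Algebra A 𝒦] [IsFractionRing A 𝒦] [Algebra 𝒦 𝕂] [Algebra A 𝕂]
    [IsScalarTower A 𝒦 𝕂] (ℒ : IntermediateField 𝒦 𝕂) [FiniteDimensional 𝒦 ℒ] :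
    ∃ (q r : ℕ) (ω : Fin r → 𝕂) (d : A) (C : ℝ), 1 ≤ q ∧ d ≠ 0 ∧ 1 ≤ C ∧
      (∀ j, IsAlgebraic A (ω j)) ∧
      (∀ (τ : Type) (s : Finset τ) (f : τ → 𝕂), (∑ i ∈ s, f i) ^ q = ∑ i ∈ s, f i ^ q) ∧
      ∀ c : ℒ, IsIntegral A (c : 𝕂) → ∀ H : ℝ, (∀ σ : ℒ →ₐ[𝒦] 𝕂, ‖σ c‖ ≤ H) →
        ∃ a : Fin r → A, algebraMap A 𝕂 d * (c : 𝕂) ^ q = ∑ j, algebraMap A 𝕂 (a j) * ω j ∧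
          ∀ j, ‖algebraMap A 𝕂 (a j)‖ ≤ C * H ^ q := by
  classical
  let E := separableClosure 𝒦 ℒ
  let p := ringExpChar E
  let e := IsPurelyInseparable.exponent E ℒ
  let b := Module.finBasis 𝒦 E
  let bD := b.traceDual
  have : Algebra.IsAlgebraic A E := by
    have : Algebra.IsAlgebraic 𝒦 E := inferInstance
    exact (IsFractionRing.comap_isAlgebraic_iff (A := A) (K := 𝒦) (C := E)).2 this
  obtain ⟨d, hd0, hd⟩ := Algebra.IsAlgebraic.exists_integral_multiples A
    (Finset.univ.image bD)
  have : ExpChar E p := inferInstance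
  have : ExpChar 𝕂 p := expChar_of_injective_algebraMap
    (algebraMap E 𝕂).injective p
  let C : ℝ := 1 + ∑ i, ∑ σ : E →ₐ[𝒦] 𝕂, ‖σ (d • bD i)‖
  refine ⟨p ^ e, _, fun j => ((b j : ℒ) : 𝕂), d, C, ?_, hd0, ?_, ?_, ?_, ?_⟩
  · exact Nat.one_le_pow _ _ (expChar_pos E p)
  · simp only [C]
    linarith [Finset.sum_nonneg (s := (Finset.univ)) fun i (_ : i ∈ Finset.univ) =>
      Finset.sum_nonneg (s := (Finset.univ : Finset (E →ₐ[𝒦] 𝕂)))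
        fun σ _ => norm_nonneg (σ (d • bD i))]
  · intro j
    have := Algebra.IsAlgebraic.isAlgebraic (R := A) (b j)
    exact this.algHom ((IsScalarTower.toAlgHom 𝒦 E 𝕂).restrictScalars A)
  · intro τ s f
    exact sum_pow_char_pow ..
  · intro c hc H hH
    obtain ⟨y, hy⟩ := IsPurelyInseparable.exponent_def E c
    have hy' : algebraMap E ℒ y = c ^ p ^ e := hy
    have hyK : ((y : ℒ) : 𝕂) = (c : 𝕂) ^ p ^ e := by
      rw [show (y : ℒ) = c ^ p ^ e from hy']; rfl
    have hyint : IsIntegral A y := by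
      have h1 : IsIntegral A (((IsScalarTower.toAlgHom 𝒦 E 𝕂).restrictScalars A) y) := by
        have : ((IsScalarTower.toAlgHom 𝒦 E 𝕂).restrictScalars A) y = (c : 𝕂) ^ p ^ e := hyK
        rw [this]; exact hc.pow _
      exact (isIntegral_algHom_iff _ (RingHom.injective _)).1 h1
    have hσ : ∀ σ : E →ₐ[𝒦] 𝕂, ‖σ y‖ ≤ H ^ p ^ e := by
      intro σ
      obtain ⟨φ, hφ⟩ := IsAlgClosed.surjective_domRestrict_of_isAlgebraic
        (K := 𝒦) (L := E) (M := 𝕂) (E := ℒ) σ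
      have : σ y = (φ c) ^ p ^ e := by
        rw [← map_pow, ← hy', ← hφ]; rfl
      rw [this, norm_pow]
      gcongr
      exact hH φ
    have htr : ∀ i, ∃ a : A, algebraMap A 𝒦 a = Algebra.trace 𝒦 E (y * (d • bD i)) := by
      intro i
      apply IsIntegrallyClosed.isIntegral_iff.1
      apply Algebra.isIntegral_trace
      exact hyint.mul (hd _ (Finset.mem_image_of_mem _ (Finset.mem_univ i)))
    choose a ha using htr
    refine ⟨a, ?_, fun i => ?_⟩
    · have h1 : d • y = ∑ i, a i • b i := by
        have h2 := b.sum_repr y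
        have h3 : ∀ i, d • (b.repr y i) = algebraMap A 𝒦 (a i) := by
          intro i
          rw [ha]
          have h4 : b.repr y i = Algebra.traceForm 𝒦 E y (bD i) := by
            have := bD.traceDual_repr_apply y i
            rw [b.traceDual_traceDual] at this
            exact this
          rw [h4, Algebra.traceForm_apply, mul_smul_comm,
            ← algebraMap_smul 𝒦 d (y * bD i), map_smul, algebraMap_smul]
        conv_lhs => rw [← h2, Finset.smul_sum]
        refine Finset.sum_congr rfl fun i _ => ?_
        rw [← smul_assoc, h3, algebraMap_smul]
      have h5 := congrArg ((IsScalarTower.toAlgHom 𝒦 E 𝕂).restrictScalars A) h1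
      rw [map_smul, map_sum] at h5
      simp_rw [map_smul, Algebra.smul_def] at h5
      rw [← hyK]
      exact h5
    · rw [IsScalarTower.algebraMap_apply A 𝒦 𝕂, ha, trace_eq_sum_embeddings 𝕂]
      have hH0 : 0 ≤ H ^ p ^ e := (norm_nonneg _).trans (hσ (IsScalarTower.toAlgHom 𝒦 E 𝕂))
      calc ‖∑ σ : E →ₐ[𝒦] 𝕂, σ (y * d • bD i)‖
          ≤ ∑ σ : E →ₐ[𝒦] 𝕂, ‖σ (d • bD i)‖ * H ^ p ^ e := by
            refine (norm_sum_le _ _).trans (Finset.sum_le_sum fun σ _ => ?_)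
            rw [map_mul, norm_mul, mul_comm]
            exact mul_le_mul_of_nonneg_left (hσ σ) (norm_nonneg _)
        _ = (∑ σ : E →ₐ[𝒦] 𝕂, ‖σ (d • bD i)‖) * H ^ p ^ e := by rw [Finset.sum_mul]
        _ ≤ C * H ^ p ^ e := by
            refine mul_le_mul_of_nonneg_right ?_ hH0
            have := Finset.single_le_sum (f := fun i => ∑ σ : E →ₐ[𝒦] 𝕂, ‖σ (d • bD i)‖)
              (fun i _ => Finset.sum_nonneg fun σ _ => norm_nonneg _) (Finset.mem_univ i)
            simp only [C]
            linarith

end Coef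

end PhilC

namespace PhilC

lemma Rep.prod {A 𝕂 : Type*} [CommRing A] [NormedField 𝕂] [Algebra A 𝕂] {ι κ τ : Type*}
    [Fintype κ] {x : ι → 𝕂} {g : κ → 𝕂} (s : Finset τ) {z : τ → 𝕂} {N : τ → ℕ} {Λ : τ → ℝ}
    (h : ∀ i ∈ s, Rep A x g (z i) (N i) (Λ i)) :
    Rep A x g (∏ i ∈ s, z i) (∑ i ∈ s, N i) (Fintype.card κ * ∏ i ∈ s, Λ i) := by
  classical
  induction s using Finset.induction_on with
  | empty => simpa using Rep.one
  | insert a s ha ih =>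
    rw [Finset.sum_insert ha, Finset.prod_insert ha, Finset.prod_insert ha]
    have := (h a (Finset.mem_insert_self _ _)).mul
      (ih fun i hi => h i (Finset.mem_insert_of_mem hi))
    exact this.mono le_rfl (by apply le_of_eq; ring)

lemma norm_le_of_height {𝒦 𝕂 : Type*} [Field 𝒦] [NormedField 𝕂] [Algebra 𝒦 𝕂]
    (ℒ : IntermediateField 𝒦 𝕂) [FiniteDimensional 𝒦 ℒ] {m : ℕ} (Q : MvPolynomial (Fin m) ℒ)
    (h : ℝ) (hQ : coeffProjHeight 𝒦 𝕂 ℒ Q ≤ h) (e : Fin m →₀ ℕ) (σ : ℒ →ₐ[𝒦] 𝕂) :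
    ‖σ (Q.coeff e)‖ ≤ Real.exp (Module.finrank 𝒦 ℒ * h) := by
  classical
  by_cases he : e ∈ Q.support
  swap
  · rw [MvPolynomial.notMem_support_iff.1 he]; simpa using (Real.exp_pos _).le
  rw [coeffProjHeight, finsum_eq_sum_of_fintype] at hQ
  have hr : (0 : ℝ) < Module.finrank 𝒦 ℒ := by exact_mod_cast Module.finrank_pos
  rw [inv_mul_le_iff₀ hr] at hQ
  set F : (ℒ →ₐ[𝒦] 𝕂) → ℝ := fun σ =>
    max 1 ((Q.support.sup fun mo => ‖σ (Q.coeff mo)‖₊ : NNReal) : ℝ) with hF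
  have h1 : Real.log (F σ) ≤ ∑ σ, Real.log (F σ) :=
    Finset.single_le_sum (f := fun σ => Real.log (F σ))
      (fun σ _ => Real.log_nonneg (le_max_left _ _)) (Finset.mem_univ σ)
  have h2 : Real.log (F σ) ≤ Module.finrank 𝒦 ℒ * h := h1.trans hQ
  have h3 : F σ ≤ Real.exp (Module.finrank 𝒦 ℒ * h) :=
    (Real.log_le_iff_le_exp (lt_of_lt_of_le one_pos (le_max_left _ _))).1 h2
  refine le_trans (le_trans ?_ (le_max_right _ _)) h3
  have h4 := Finset.le_sup (f := fun mo => ‖σ (Q.coeff mo)‖₊) he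
  exact_mod_cast h4

lemma card_support_le {R : Type*} [CommRing R] {m : ℕ} (Q : MvPolynomial (Fin m) R) (n : ℕ)
    (h : ∀ i, Q.degreeOf i ≤ n) : Q.support.card ≤ (n + 1) ^ m := by
  classical
  have : Q.support.card ≤ (Fintype.piFinset fun _ : Fin m => Finset.range (n + 1)).card := by
    refine Finset.card_le_card_of_injOn (fun e => (e : Fin m → ℕ)) (fun e he => ?_)
      (fun e _ e' _ hh => DFunLike.coe_injective hh)
    simp only [Fintype.coe_piFinset, Set.mem_pi, Finset.coe_range, Set.mem_Iio, Set.mem_univ,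
      forall_true_left]
    intro i
    have := MvPolynomial.degreeOf_le_iff.1 (h i) e he
    omega
  simpa [Fintype.card_piFinset] using this

lemma exists_Z (A 𝒦 𝕂 : Type*) [CommRing A] [IsDomain A] [IsIntegrallyClosed A] [Field 𝒦]
    [NormedField 𝕂]
    [IsAlgClosed 𝕂] [Algebra A 𝒦] [IsFractionRing A 𝒦] [Algebra 𝒦 𝕂] [Algebra A 𝕂]
    [IsScalarTower A 𝒦 𝕂] (ℒ : IntermediateField 𝒦 𝕂) [FiniteDimensional 𝒦 ℒ]
    {m : ℕ} (α : Fin m → 𝕂) {ι : Type*} (x : ι → 𝕂)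
    (hα : ∀ i, IsAlgebraic (Algebra.adjoin A (Set.range x)) (α i)) :
    ∃ (D : ℕ) (g : Fin D → 𝕂) (q : ℕ) (C : ℝ), 1 ≤ q ∧ 1 ≤ C ∧ (∃ j, g j ≠ 0) ∧
      ∀ (Q : MvPolynomial (Fin m) ℒ) (δ s : ℝ), 1 ≤ δ → δ ≤ s →
        (∀ mo, IsIntegral A ((Q.coeff mo : ℒ) : 𝕂)) → (∀ i, ((Q.degreeOf i : ℕ) : ℝ) ≤ δ) →
        coeffProjHeight 𝒦 𝕂 ℒ Q ≤ s →
        MvPolynomial.eval α (MvPolynomial.map (algebraMap ℒ 𝕂) Q) ≠ 0 →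
        ∃ Z : 𝕂, Z ≠ 0 ∧ Rep A x g Z ⌊C * δ⌋₊ (Real.exp (C * s)) ∧
          |Real.log ‖Z‖ -
            q * Real.log ‖MvPolynomial.eval α (MvPolynomial.map (algebraMap ℒ 𝕂) Q)‖| ≤ C * δ := by
  classical
  have hinjAK : Function.Injective (algebraMap A 𝕂) := by
    rw [IsScalarTower.algebraMap_eq A 𝒦 𝕂]
    exact (algebraMap 𝒦 𝕂).injective.comp (IsFractionRing.injective A 𝒦)
  obtain ⟨q, r, ω, d, C₁, hq, hd, hC₁, hω, hpow, hcoef⟩ := exists_coef A 𝒦 𝕂 ℒ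
  obtain ⟨D, g, b, hb, hg, N₀, Λ₀, hrep⟩ := exists_rep (A := A) x (Sum.elim ω α) (by
    rintro (j | i)
    · exact (hω j).extendScalars (fun a a' h => hinjAK (congrArg Subtype.val h))
    · exact hα i)
  set B := MvPolynomial.aeval x b with hB
  have hD : 1 ≤ D := by obtain ⟨j, _⟩ := hg; exact j.pos
  have hDR : (1 : ℝ) ≤ D := by exact_mod_cast hD
  -- uniform constants
  let N := N₀ + b.totalDegree
  let Λ : ℝ := 1 + |Λ₀| + D * plen 𝕂 b
  have hpl := plen_nonneg 𝕂 b
  have hΛ1 : 1 ≤ Λ := by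
    have : 0 ≤ D * plen 𝕂 b := by positivity
    simp only [Λ]; linarith [abs_nonneg Λ₀]
  have hΛ0 : Λ₀ ≤ Λ := by
    have : 0 ≤ D * plen 𝕂 b := by positivity
    simp only [Λ]; linarith [le_abs_self Λ₀]
  have repω : ∀ j, Rep A x g (B * ω j) N Λ := fun j =>
    (hrep (Sum.inl j)).mono (Nat.le_add_right _ _) hΛ0
  have repα : ∀ i, Rep A x g (B * α i) N Λ := fun i =>
    (hrep (Sum.inr i)).mono (Nat.le_add_right _ _) hΛ0
  have repB : Rep A x g B N Λ := by
    refine (Rep.poly (g := g) b).mono (Nat.le_add_left _ _) ?_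
    simp only [Λ, Fintype.card_fin]; linarith [abs_nonneg Λ₀]
  let f : ℝ := Module.finrank 𝒦 ℒ
  let C : ℝ := 1 + N * (1 + q * m) + (|Real.log ‖algebraMap A 𝕂 d‖| + (1 + q * m) * |Real.log ‖B‖|)
    + (Real.log (((r : ℝ) + 1) * C₁ * D ^ (m + 2)) + m + q * f + (1 + q * m) * Real.log Λ)
  have hlogΛ : 0 ≤ Real.log Λ := Real.log_nonneg hΛ1
  have hconst : 1 ≤ ((r : ℝ) + 1) * C₁ * D ^ (m + 2) := by
    have h1 : (1 : ℝ) ≤ (r : ℝ) + 1 := by linarith [Nat.cast_nonneg (α := ℝ) r]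
    have h2 : (1 : ℝ) ≤ (D : ℝ) ^ (m + 2) := one_le_pow₀ hDR
    exact one_le_mul_of_one_le_of_one_le (one_le_mul_of_one_le_of_one_le h1 hC₁) h2
  have hlogc := Real.log_nonneg hconst
  have hf : 0 ≤ f := Nat.cast_nonneg _
  have hCa : (N : ℝ) * (1 + q * m) ≤ C := by
    have : 0 ≤ (1 + q * m : ℝ) * |Real.log ‖B‖| := by positivity
    have : 0 ≤ (1 + q * m : ℝ) * Real.log Λ := by positivity
    have : 0 ≤ (q : ℝ) * f := by positivity
    simp only [C]; linarith [abs_nonneg (Real.log ‖algebraMap A 𝕂 d‖),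
      Nat.cast_nonneg (α := ℝ) m]
  have hCb : |Real.log ‖algebraMap A 𝕂 d‖| + (1 + q * m) * |Real.log ‖B‖| ≤ C := by
    have : 0 ≤ (N : ℝ) * (1 + q * m) := by positivity
    have : 0 ≤ (1 + q * m : ℝ) * Real.log Λ := by positivity
    have : 0 ≤ (q : ℝ) * f := by positivity
    simp only [C]; linarith [Nat.cast_nonneg (α := ℝ) m]
  have hCc : Real.log (((r : ℝ) + 1) * C₁ * D ^ (m + 2)) + m + q * f + (1 + q * m) * Real.log Λ
      ≤ C := by
    have : 0 ≤ (N : ℝ) * (1 + q * m) := by positivity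
    have : 0 ≤ (1 + q * m : ℝ) * |Real.log ‖B‖| := by positivity
    simp only [C]; linarith [abs_nonneg (Real.log ‖algebraMap A 𝕂 d‖)]
  have hC1 : 1 ≤ C := by
    have : 0 ≤ (N : ℝ) * (1 + q * m) := by positivity
    have : 0 ≤ (1 + q * m : ℝ) * |Real.log ‖B‖| := by positivity
    have : 0 ≤ (1 + q * m : ℝ) * Real.log Λ := by positivity
    have : 0 ≤ (q : ℝ) * f := by positivity
    simp only [C]; linarith [abs_nonneg (Real.log ‖algebraMap A 𝕂 d‖),
      Nat.cast_nonneg (α := ℝ) m]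
  refine ⟨D, g, q, C, hq, hC1, hg, fun Q δ s hδ hs hint hdeg hht hne => ?_⟩
  set y := MvPolynomial.eval α (MvPolynomial.map (algebraMap ℒ 𝕂) Q) with hy
  have hdK : algebraMap A 𝕂 d ≠ 0 := fun h => hd (hinjAK (by rw [h, map_zero]))
  set ℓ : ℕ := 1 + q * (m * ⌊δ⌋₊) with hℓ
  have hfl : (⌊δ⌋₊ : ℝ) ≤ δ := Nat.floor_le (by linarith)
  have hℓR : (ℓ : ℝ) ≤ (1 + q * m) * δ := by
    rw [hℓ]; push_cast
    have : (q : ℝ) * (m * ⌊δ⌋₊) ≤ q * (m * δ) := by gcongr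
    nlinarith
  have hdegN : ∀ i, Q.degreeOf i ≤ ⌊δ⌋₊ := fun i => Nat.le_floor (hdeg i)
  have hedeg : ∀ e ∈ Q.support, ∑ i, e i ≤ m * ⌊δ⌋₊ := by
    intro e he
    calc ∑ i, e i ≤ ∑ _i : Fin m, ⌊δ⌋₊ := Finset.sum_le_sum fun i _ =>
          MvPolynomial.degreeOf_le_iff.1 (hdegN i) e he
      _ = _ := by simp
  choose a ha1 ha2 using fun e => hcoef (Q.coeff e) (hint e) (Real.exp (f * s))
    (fun σ => norm_le_of_height ℒ Q s hht e σ)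
  -- the expansion
  have hyexp : y = ∑ e ∈ Q.support, ((Q.coeff e : ℒ) : 𝕂) * ∏ i, α i ^ e i := by
    rw [hy, MvPolynomial.eval_map, MvPolynomial.eval₂_eq']
    rfl
  have hZ : algebraMap A 𝕂 d * B ^ ℓ * y ^ q = ∑ e ∈ Q.support, ∑ j,
      algebraMap A 𝕂 (a e j) * ((B * ω j) * ((∏ i, (B * α i) ^ (q * e i)) *
        B ^ (ℓ - 1 - q * ∑ i, e i))) := by
    rw [hyexp, hpow, Finset.mul_sum]
    refine Finset.sum_congr rfl fun e he => ?_
    have h1 : B ^ ℓ = B * (B ^ (q * ∑ i, e i) * B ^ (ℓ - 1 - q * ∑ i, e i)) := by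
      rw [← pow_add, ← pow_succ']
      congr 1
      have := Nat.mul_le_mul_left q (hedeg e he)
      omega
    have h2 : ∏ i, (B * α i) ^ (q * e i) = B ^ (q * ∑ i, e i) * (∏ i, α i ^ e i) ^ q := by
      simp_rw [mul_pow]
      rw [Finset.prod_mul_distrib, Finset.prod_pow_eq_pow_sum, ← Finset.mul_sum,
        ← Finset.prod_pow]
      congr 1
      exact Finset.prod_congr rfl fun i _ => by rw [← pow_mul, mul_comm]
    calc algebraMap A 𝕂 d * B ^ ℓ * (((Q.coeff e : ℒ) : 𝕂) * ∏ i, α i ^ e i) ^ q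
        = (algebraMap A 𝕂 d * ((Q.coeff e : ℒ) : 𝕂) ^ q) * (B ^ ℓ * (∏ i, α i ^ e i) ^ q) := by
          rw [mul_pow]; ring
      _ = _ := by
          rw [ha1, Finset.sum_mul]
          refine Finset.sum_congr rfl fun j _ => ?_
          rw [h1, h2]; ring
  refine ⟨algebraMap A 𝕂 d * B ^ ℓ * y ^ q, ?_, ?_, ?_⟩
  · exact mul_ne_zero (mul_ne_zero hdK (pow_ne_zero _ hb)) (pow_ne_zero _ hne)
  · rw [hZ]
    have hterm : ∀ e ∈ Q.support, ∀ j ∈ (Finset.univ : Finset (Fin r)),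
        Rep A x g (algebraMap A 𝕂 (a e j) * ((B * ω j) * ((∏ i, (B * α i) ^ (q * e i)) *
          B ^ (ℓ - 1 - q * ∑ i, e i)))) (ℓ * N)
          (C₁ * Real.exp (f * s) ^ q * (D ^ (m + 2) * Λ ^ ℓ)) := by
      intro e he j _
      have h1 := (repω j).mul ((Rep.prod Finset.univ fun i _ =>
        (repα i).pow (q * e i)).mul (repB.pow (ℓ - 1 - q * ∑ i, e i)))
      have hle : q * ∑ i, e i ≤ ℓ - 1 := by
        have := Nat.mul_le_mul_left q (hedeg e he)
        omega
      refine (h1.smul (a e j)).mono ?_ ?_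
      · rw [← Finset.sum_mul, ← Finset.mul_sum, ← add_mul]
        nth_rewrite 1 [← one_mul N]
        rw [← add_mul]
        apply Nat.mul_le_mul_right
        omega
      · refine mul_le_mul (ha2 e j) (le_of_eq ?_) ?_ ?_
        · simp only [Fintype.card_fin]
          rw [Finset.prod_mul_distrib, Finset.prod_const, Finset.card_univ, Fintype.card_fin,
            Finset.prod_pow_eq_pow_sum, ← Finset.mul_sum]
          have h3 : Λ ^ ℓ = Λ * (Λ ^ (q * ∑ i, e i) * Λ ^ (ℓ - 1 - q * ∑ i, e i)) := by
            rw [← pow_add, ← pow_succ']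
            congr 1
            omega
          rw [h3]; ring
        · positivity
        · positivity
    have h2 := Rep.sum Q.support fun e he => Rep.sum Finset.univ (hterm e he)
    refine h2.mono ?_ ?_
    · apply Nat.le_floor
      push_cast
      calc (ℓ : ℝ) * N ≤ ((1 + q * m) * δ) * N := by gcongr
        _ = (N * (1 + q * m)) * δ := by ring
        _ ≤ C * δ := by gcongr
    · simp only [Finset.sum_const, Finset.card_univ, Fintype.card_fin, nsmul_eq_mul]
      have hcard : (Q.support.card : ℝ) ≤ Real.exp (m * s) := by
        have h3 := card_support_le Q _ hdegN
        calc (Q.support.card : ℝ) ≤ ((⌊δ⌋₊ : ℝ) + 1) ^ m := by exact_mod_cast h3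
          _ ≤ (Real.exp s) ^ m := by
            gcongr
            linarith [Real.add_one_le_exp s]
          _ = _ := by rw [← Real.exp_nat_mul]
      have hΛe : Λ ^ ℓ ≤ Real.exp ((1 + q * m) * Real.log Λ * s) := by
        calc Λ ^ ℓ = Real.exp (ℓ * Real.log Λ) := by
              rw [Real.exp_nat_mul, Real.exp_log (by linarith)]
          _ ≤ _ := by
            apply Real.exp_le_exp.2
            have : (ℓ : ℝ) * Real.log Λ ≤ ((1 + q * m) * s) * Real.log Λ := by
              apply mul_le_mul_of_nonneg_right _ hlogΛ
              refine hℓR.trans ?_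
              gcongr
            linarith
      have hce : ((r : ℝ) + 1) * C₁ * D ^ (m + 2) ≤
          Real.exp (Real.log (((r : ℝ) + 1) * C₁ * D ^ (m + 2)) * s) := by
        conv_lhs => rw [← Real.exp_log (lt_of_lt_of_le one_pos hconst)]
        apply Real.exp_le_exp.2
        nlinarith
      calc (Q.support.card : ℝ) * (r * (C₁ * Real.exp (f * s) ^ q * (D ^ (m + 2) * Λ ^ ℓ)))
          ≤ Real.exp (m * s) * (((r : ℝ) + 1) * (C₁ * Real.exp (f * s) ^ q *
              (D ^ (m + 2) * Real.exp ((1 + q * m) * Real.log Λ * s)))) := by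
            gcongr
            linarith
        _ = (((r : ℝ) + 1) * C₁ * D ^ (m + 2)) * (Real.exp (m * s) * Real.exp (q * (f * s)) *
              Real.exp ((1 + q * m) * Real.log Λ * s)) := by
            rw [Real.exp_nat_mul (f * s) q]; ring
        _ ≤ Real.exp (Real.log (((r : ℝ) + 1) * C₁ * D ^ (m + 2)) * s) *
              (Real.exp (m * s) * Real.exp (q * (f * s)) *
              Real.exp ((1 + q * m) * Real.log Λ * s)) := by gcongr
        _ = Real.exp ((Real.log (((r : ℝ) + 1) * C₁ * D ^ (m + 2)) + m + q * f +
              (1 + q * m) * Real.log Λ) * s) := by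
            rw [← Real.exp_add, ← Real.exp_add, ← Real.exp_add]; ring_nf
        _ ≤ Real.exp (C * s) := by
            apply Real.exp_le_exp.2
            gcongr
            linarith
  · rw [norm_mul, norm_mul, norm_pow, norm_pow, Real.log_mul, Real.log_mul, Real.log_pow,
      Real.log_pow, add_sub_cancel_right]
    · calc |Real.log ‖algebraMap A 𝕂 d‖ + ℓ * Real.log ‖B‖|
          ≤ |Real.log ‖algebraMap A 𝕂 d‖| + ℓ * |Real.log ‖B‖| := by
            refine (abs_add_le _ _).trans ?_
            rw [abs_mul, Nat.abs_cast]
        _ ≤ |Real.log ‖algebraMap A 𝕂 d‖| * δ + ((1 + q * m) * δ) * |Real.log ‖B‖| := by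
            gcongr
            exact le_mul_of_one_le_right (abs_nonneg _) hδ
        _ = (|Real.log ‖algebraMap A 𝕂 d‖| + (1 + q * m) * |Real.log ‖B‖|) * δ := by ring
        _ ≤ C * δ := by gcongr
    · exact norm_ne_zero_iff.2 hdK
    · exact pow_ne_zero _ (norm_ne_zero_iff.2 hb)
    · exact mul_ne_zero (norm_ne_zero_iff.2 hdK) (pow_ne_zero _ (norm_ne_zero_iff.2 hb))
    · exact pow_ne_zero _ (norm_ne_zero_iff.2 hne)

end PhilC

namespace PhilC

/-- A form of Siegel's lemma. -/
def SiegelProp (A 𝕂 : Type*) [CommRing A] [NormedField 𝕂] [Algebra A 𝕂] (Cs : ℝ) : Prop :=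
  ∀ (μ κ : Type) [Fintype μ] [Fintype κ], 2 * Fintype.card μ ≤ Fintype.card κ →
    0 < Fintype.card κ → ∀ (a : Matrix μ κ A) (H : ℝ), 1 ≤ H →
    (∀ i j, ‖algebraMap A 𝕂 (a i j)‖ ≤ H) →
    ∃ p : κ → A, p ≠ 0 ∧ (∀ i, ∑ j, a i j * p j = 0) ∧
      ∀ j, ‖algebraMap A 𝕂 (p j)‖ ≤ Cs * Fintype.card κ * H

lemma exists_step (u : ℕ → ℝ) (n₀ n : ℕ) (hn : n₀ ≤ n) (L : ℝ) (h0 : u n₀ ≤ L) (h1 : L < u n) :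
    ∃ j, n₀ ≤ j ∧ j < n ∧ u j ≤ L ∧ L < u (j + 1) := by
  induction n, hn using Nat.le_induction with
  | base => exact absurd h1 (not_lt.2 h0)
  | succ n hn ih =>
    by_cases h : u n ≤ L
    · exact ⟨n, hn, Nat.lt_succ_self n, h, h1⟩
    · obtain ⟨j, a, b, c, d⟩ := ih (not_le.1 h)
      exact ⟨j, a, b.trans (Nat.lt_succ_self n), c, d⟩

lemma greedy (u : ℕ → ℝ) (n₀ n : ℕ) (hn : n₀ ≤ n) (B : ℝ) (hB1 : 1 ≤ B)
    (hpos : ∀ j, n₀ ≤ j → 0 < u j) (hB : ∀ j, n₀ ≤ j → u (j + 1) ≤ B * u j) (r : ℕ) :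
    ∀ L : ℝ, 0 ≤ L → L < u n → ∃ l : List ℕ, l.length ≤ r ∧ (∀ j ∈ l, n₀ ≤ j ∧ j < n) ∧
      (l.map u).sum ≤ L ∧ L - (l.map u).sum ≤ max (u n₀) ((1 - 1 / B) ^ r * L) := by
  have hb : 0 ≤ 1 - 1 / B := by
    have : 1 / B ≤ 1 := by rw [div_le_one (by linarith)]; exact hB1
    linarith
  induction r with
  | zero =>
    intro L hL h
    exact ⟨[], by simp, by simp, by simpa using hL, by simp⟩
  | succ r ih =>
    intro L hL h
    by_cases h0 : u n₀ ≤ L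
    · obtain ⟨j, a, b, c, d⟩ := exists_step u n₀ n hn L h0 h
      have hj := hpos j a
      obtain ⟨l, l1, l2, l3, l4⟩ := ih (L - u j) (by linarith) (by linarith)
      refine ⟨j :: l, by simpa using l1, ?_, ?_, ?_⟩
      · intro i hi
        rcases List.mem_cons.1 hi with rfl | hi
        · exact ⟨a, b⟩
        · exact l2 i hi
      · simp only [List.map_cons, List.sum_cons]; linarith
      · simp only [List.map_cons, List.sum_cons]
        have e : L - (u j + (l.map u).sum) = L - u j - (l.map u).sum := by ring
        rw [e]
        refine l4.trans (max_le_max le_rfl ?_)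
        rw [pow_succ, mul_assoc]
        refine mul_le_mul_of_nonneg_left ?_ (pow_nonneg hb _)
        have : L / B ≤ u j := by
          rw [div_le_iff₀ (by linarith)]
          have := hB j a
          linarith [mul_comm B (u j)]
        have e2 : (1 - 1 / B) * L = L - L / B := by ring
        linarith
    · refine ⟨[], by simp, by simp, by simpa using hL, ?_⟩
      simp only [List.map_nil, List.sum_nil, sub_zero]
      exact le_max_of_le_left (not_le.1 h0).le

section
variable {A 𝕂 : Type*} [CommRing A] [NormedField 𝕂] [Algebra A 𝕂]

lemma relation {Cs : ℝ} (hS : SiegelProp A 𝕂 Cs) {D : ℕ} (g : Fin D → 𝕂) (hg : ∃ j, g j ≠ 0)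
    {t : ℕ} (x : Fin t → 𝕂) (N : ℕ) (Λ : ℝ) (hΛ : 1 ≤ Λ) (K : ℕ)
    (hK : K = 2 * (D * D * (N + 1) ^ t)) (W : Fin K → 𝕂) (hW : ∀ i, Rep A x g (W i) N Λ) :
    ∃ p : Fin K → A, p ≠ 0 ∧ ∑ i, algebraMap A 𝕂 (p i) * W i = 0 ∧
      ∀ i, ‖algebraMap A 𝕂 (p i)‖ ≤ Cs * K * Λ := by
  classical
  obtain ⟨j₀, hj₀⟩ := hg
  have hD : 1 ≤ D := by have := j₀.2; omega
  choose T hT hTd hTl using hW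
  let ex : (Fin t → Fin (N + 1)) → (Fin t →₀ ℕ) :=
    fun e => Finsupp.equivFunOnFinite.symm (fun i => (e i : ℕ))
  have hcard : Fintype.card (Fin D × Fin D × (Fin t → Fin (N + 1))) = D * D * (N + 1) ^ t := by
    simp [Fintype.card_prod, mul_assoc]
  have hNt : 0 < (N + 1) ^ t := by positivity
  obtain ⟨p, hp0, hp1, hp2⟩ := hS (Fin D × Fin D × (Fin t → Fin (N + 1))) (Fin K)
    (by rw [hcard, Fintype.card_fin, hK]) (by rw [Fintype.card_fin, hK]; positivity)
    (fun q i => (T i q.1 q.2.1).coeff (ex q.2.2)) Λ hΛ (by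
      intro q i
      refine (norm_coeff_le_plen 𝕂 _ _).trans (le_trans ?_ (hTl i q.1 q.2.1))
      rw [Fintype.card_fin]
      exact le_mul_of_one_le_left (plen_nonneg _ _) (by exact_mod_cast hD))
  rw [Fintype.card_fin] at hp2
  refine ⟨p, hp0, ?_, hp2⟩
  have key : ∀ a b, ∑ i, MvPolynomial.C (p i) * T i a b = 0 := by
    intro a b
    ext e
    rw [MvPolynomial.coeff_sum, MvPolynomial.coeff_zero]
    simp only [MvPolynomial.coeff_C_mul]
    by_cases he : ∀ i, e i < N + 1
    · have := hp1 (a, b, fun i => ⟨e i, he i⟩)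
      have e2 : ex (fun i => ⟨e i, he i⟩) = e := by ext i; simp [ex]
      simp only [e2] at this
      rw [← this]
      exact Finset.sum_congr rfl fun i _ => mul_comm _ _
    · push Not at he
      obtain ⟨i₀, hi₀⟩ := he
      refine Finset.sum_eq_zero fun i _ => ?_
      rw [MvPolynomial.coeff_eq_zero_of_totalDegree_lt, mul_zero]
      refine lt_of_le_of_lt (hTd i a b) ?_
      have h1 : e i₀ ≤ ∑ i ∈ e.support, e i := by
        refine Finset.single_le_sum (f := fun i => e i) (fun _ _ => Nat.zero_le _) ?_
        rw [Finsupp.mem_support_iff]; omega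
      omega
  have h2 : (∑ i, algebraMap A 𝕂 (p i) * W i) * g j₀ = 0 := by
    calc (∑ i, algebraMap A 𝕂 (p i) * W i) * g j₀
        = ∑ i, algebraMap A 𝕂 (p i) * ∑ b, MvPolynomial.aeval x (T i j₀ b) * g b := by
          rw [Finset.sum_mul]
          refine Finset.sum_congr rfl fun i _ => ?_
          rw [mul_assoc, hT]
      _ = ∑ b, MvPolynomial.aeval x (∑ i, MvPolynomial.C (p i) * T i j₀ b) * g b := by
          simp only [map_sum, map_mul, Finset.mul_sum, Finset.sum_mul, MvPolynomial.aeval_C]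
          rw [Finset.sum_comm]
          simp only [mul_assoc]
      _ = 0 := by simp [key]
  exact (mul_eq_zero.1 h2).resolve_right hj₀

lemma no_relation (hA : ∀ a : A, a ≠ 0 → 1 ≤ ‖algebraMap A 𝕂 a‖) {K : ℕ} (p : Fin K → A)
    (hp : p ≠ 0) (W : Fin K → 𝕂) (hsum : ∑ i, algebraMap A 𝕂 (p i) * W i = 0)
    (P G : ℝ) (hG : 0 < G) (hP : ∀ i, ‖algebraMap A 𝕂 (p i)‖ ≤ P)
    (hW0 : ∀ i : Fin K, Real.exp (-(((i : ℕ) : ℝ) + 1) * G) ≤ ‖W i‖)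
    (hW1 : ∀ i : Fin K, ‖W i‖ ≤ Real.exp (-(((i : ℕ) : ℝ) + 1) * G + G / 3)) :
    1 ≤ K * P * Real.exp (-(2 * G / 3)) := by
  classical
  have hne : (Finset.univ.filter fun i => p i ≠ 0).Nonempty := by
    obtain ⟨i, hi⟩ := Function.ne_iff.1 hp
    exact ⟨i, by simpa using hi⟩
  obtain ⟨i₀, hi₀, hmin⟩ := Finset.exists_min_image _ (fun i : Fin K => (i : ℕ)) hne
  have hi₀' : p i₀ ≠ 0 := (Finset.mem_filter.1 hi₀).2
  have hP0 : 0 ≤ P := (norm_nonneg _).trans (hP i₀)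
  have h1 : algebraMap A 𝕂 (p i₀) * W i₀ =
      -∑ i ∈ Finset.univ.erase i₀, algebraMap A 𝕂 (p i) * W i := by
    rw [← Finset.add_sum_erase _ _ (Finset.mem_univ i₀)] at hsum
    exact eq_neg_of_add_eq_zero_left hsum
  set E := Real.exp (-(((i₀ : ℕ) : ℝ) + 1) * G) with hE
  have hEpos : 0 < E := Real.exp_pos _
  have h2 : E ≤ ‖algebraMap A 𝕂 (p i₀) * W i₀‖ := by
    rw [norm_mul]
    calc E = 1 * E := (one_mul _).symm
      _ ≤ _ := mul_le_mul (hA _ hi₀') (hW0 i₀) hEpos.le (norm_nonneg _)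
  have h3 : ∀ i ∈ Finset.univ.erase i₀, ‖algebraMap A 𝕂 (p i) * W i‖ ≤
      P * (E * Real.exp (-(2 * G / 3))) := by
    intro i hi
    by_cases hpi : p i = 0
    · rw [hpi]; simp; positivity
    · have h4 : (i₀ : ℕ) ≤ i := hmin i (by simpa using hpi)
      have h5 : (i₀ : ℕ) ≠ i := fun h => (Finset.mem_erase.1 hi).1 (Fin.ext h.symm)
      have h6 : (i₀ : ℕ) + 1 ≤ i := by omega
      have h7 : ((i₀ : ℕ) : ℝ) + 1 ≤ (i : ℕ) := by exact_mod_cast h6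
      rw [norm_mul]
      refine mul_le_mul (hP i) ((hW1 i).trans ?_) (norm_nonneg _) hP0
      rw [hE, ← Real.exp_add]
      refine Real.exp_le_exp.2 ?_
      nlinarith
  have h8 : E ≤ K * (P * (E * Real.exp (-(2 * G / 3)))) := by
    calc E ≤ _ := h2
      _ = ‖∑ i ∈ Finset.univ.erase i₀, algebraMap A 𝕂 (p i) * W i‖ := by rw [h1, norm_neg]
      _ ≤ ∑ i ∈ Finset.univ.erase i₀, ‖algebraMap A 𝕂 (p i) * W i‖ := norm_sum_le _ _
      _ ≤ ∑ i ∈ Finset.univ.erase i₀, P * (E * Real.exp (-(2 * G / 3))) :=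
        Finset.sum_le_sum h3
      _ ≤ ∑ i : Fin K, P * (E * Real.exp (-(2 * G / 3))) :=
        Finset.sum_le_sum_of_subset_of_nonneg (Finset.subset_univ _)
          fun _ _ _ => by positivity
      _ = _ := by simp
  have h9 : E * 1 ≤ E * (K * P * Real.exp (-(2 * G / 3))) := by
    rw [mul_one]; refine h8.trans (le_of_eq (by ring))
  exact le_of_mul_le_mul_left h9 hEpos

end

end PhilC

namespace PhilC

section
variable {A 𝕂 : Type*} [CommRing A] [NormedField 𝕂] [Algebra A 𝕂]

lemma norm_list_prod (Z : ℕ → 𝕂) (l : List ℕ) (h : ∀ j ∈ l, Z j ≠ 0) :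
    ‖(l.map Z).prod‖ = Real.exp (-(l.map fun j => -Real.log ‖Z j‖).sum) := by
  induction l with
  | nil => simp
  | cons a l ih =>
    have h1 : Z a ≠ 0 := h a (by simp)
    simp only [List.map_cons, List.prod_cons, List.sum_cons, norm_mul]
    rw [ih fun j hj => h j (by simp [hj]), neg_add, Real.exp_add, neg_neg,
      Real.exp_log (norm_pos_iff.2 h1)]

lemma step_false (hA : ∀ a : A, a ≠ 0 → 1 ≤ ‖algebraMap A 𝕂 a‖)
    {Cs : ℝ} (hS : SiegelProp A 𝕂 Cs) {D : ℕ} (g : Fin D → 𝕂) (hg : ∃ j, g j ≠ 0)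
    {t : ℕ} (x : Fin t → 𝕂) (C δ s B : ℝ) (hC : 1 ≤ C) (hs : 1 ≤ s) (hB : 1 ≤ B)
    (Z : ℕ → 𝕂) (n₀ n : ℕ) (hn : n₀ ≤ n)
    (hRep : ∀ j, n₀ ≤ j → j < n → Rep A x g (Z j) ⌊C * δ⌋₊ (Real.exp (C * s)))
    (hZ0 : ∀ j, n₀ ≤ j → Z j ≠ 0)
    (u : ℕ → ℝ) (hu : u = fun j => -Real.log ‖Z j‖)
    (hpos : ∀ j, n₀ ≤ j → 0 < u j) (hBu : ∀ j, n₀ ≤ j → u (j + 1) ≤ B * u j)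
    (r K : ℕ) (G : ℝ) (hr : 1 ≤ r) (hK : K = 2 * (D * D * (r * ⌊C * δ⌋₊ + 1) ^ t))
    (hG : G = 6 * C * r * s) (c1 : u n₀ ≤ G / 3) (c2 : 3 * K * (1 - 1 / B) ^ r ≤ 1)
    (c3 : Cs * D * K ^ 2 ≤ Real.exp r) (c4 : K * G < u n) : False := by
  have hr' : (1 : ℝ) ≤ r := by exact_mod_cast hr
  have hCs : 1 ≤ C * s := one_le_mul_of_one_le_of_one_le hC hs
  have hrCs : (r : ℝ) ≤ C * r * s := by nlinarith
  have hGpos : 0 < G := by rw [hG]; nlinarith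
  have hD : 1 ≤ D := by obtain ⟨j, _⟩ := hg; have := j.2; omega
  have hb : 0 ≤ 1 - 1 / B := by
    have : 1 / B ≤ 1 := by rw [div_le_one (by linarith)]; exact hB
    linarith
  have hex : ∀ i : Fin K, ∃ l : List ℕ, l.length ≤ r ∧ (∀ j ∈ l, n₀ ≤ j ∧ j < n) ∧
      (l.map u).sum ≤ ((i : ℕ) + 1) * G ∧ ((i : ℕ) + 1) * G - (l.map u).sum ≤ G / 3 := by
    intro i
    have hi : ((i : ℕ) : ℝ) + 1 ≤ K := by exact_mod_cast i.2
    have hiG : (((i : ℕ) : ℝ) + 1) * G ≤ K * G := mul_le_mul_of_nonneg_right hi hGpos.le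
    obtain ⟨l, l1, l2, l3, l4⟩ := greedy u n₀ n hn B hB hpos hBu r (((i : ℕ) + 1) * G)
      (by positivity) (by linarith)
    refine ⟨l, l1, l2, l3, l4.trans (max_le c1 ?_)⟩
    have h1 := mul_le_mul_of_nonneg_left hiG (pow_nonneg hb r)
    have h2 := mul_le_mul_of_nonneg_right c2 hGpos.le
    nlinarith
  choose l l1 l2 l3 l4 using hex
  have hexp1 : 1 ≤ Real.exp (C * s) := Real.one_le_exp (by linarith)
  have hDr : (1 : ℝ) ≤ D := by exact_mod_cast hD
  obtain ⟨p, p0, p1, p2⟩ := relation hS g hg x (r * ⌊C * δ⌋₊) (D * Real.exp (C * s) ^ r)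
    (one_le_mul_of_one_le_of_one_le hDr (one_le_pow₀ hexp1)) K hK
    (fun i => ((l i).map Z).prod) (fun i => by
      have := Rep.list_prod (A := A) (x := x) (g := g) Z ⌊C * δ⌋₊ (Real.exp (C * s)) hexp1 (l i) r (l1 i)
        (fun j hj => hRep j (l2 i j hj).1 (l2 i j hj).2)
      simpa using this)
  have hn : ∀ i : Fin K, ‖((l i).map Z).prod‖ = Real.exp (-((l i).map u).sum) := by
    intro i
    rw [norm_list_prod Z (l i) fun j hj => hZ0 j (l2 i j hj).1, hu]
  have h1 := no_relation hA p p0 _ p1 _ G hGpos p2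
    (fun i => by rw [hn]; exact Real.exp_le_exp.2 (by linarith [l3 i]))
    (fun i => by rw [hn]; exact Real.exp_le_exp.2 (by linarith [l4 i]))
  have h2 : (K : ℝ) * (Cs * K * (D * Real.exp (C * s) ^ r)) * Real.exp (-(2 * G / 3)) =
      (Cs * D * K ^ 2) * (Real.exp (r * (C * s)) * Real.exp (-(2 * G / 3))) := by
    rw [Real.exp_nat_mul]; ring
  rw [h2, ← Real.exp_add] at h1
  have h3 := mul_le_mul_of_nonneg_right c3 (Real.exp_pos (r * (C * s) + -(2 * G / 3))).le
  rw [← Real.exp_add] at h3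
  have h4 : Real.exp (r + (r * (C * s) + -(2 * G / 3))) < 1 := by
    rw [Real.exp_lt_one_iff, hG]; nlinarith
  linarith

end
end PhilC

namespace PhilC

section
variable {A 𝕂 : Type*} [CommRing A] [NormedField 𝕂] [Algebra A 𝕂]

lemma exists_root (k : ℕ) (hk : 1 ≤ k) (δ : ℕ → ℝ) (hδ1 : ∀ n, 1 ≤ δ n)
    (hδ : Tendsto δ atTop atTop) : ∃ r : ℕ → ℕ, Tendsto r atTop atTop ∧
      (∀ n, ((r n : ℕ) : ℝ) ^ k ≤ δ n) ∧ ∀ n, δ n ≤ ((r n : ℕ) + 1 : ℝ) ^ k := by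
  have hk0 : k ≠ 0 := by omega
  refine ⟨fun n => ⌊δ n ^ ((k : ℝ)⁻¹)⌋₊, ?_, ?_, ?_⟩
  · refine tendsto_nat_floor_atTop.comp ((tendsto_rpow_atTop ?_).comp hδ)
    positivity
  · intro n
    have h0 : 0 ≤ δ n := by linarith [hδ1 n]
    calc _ ≤ (δ n ^ ((k : ℝ)⁻¹)) ^ k :=
          pow_le_pow_left₀ (Nat.cast_nonneg _) (Nat.floor_le (Real.rpow_nonneg h0 _)) k
      _ = δ n := Real.rpow_inv_natCast_pow h0 hk0
  · intro n
    have h0 : 0 ≤ δ n := by linarith [hδ1 n]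
    calc δ n = (δ n ^ ((k : ℝ)⁻¹)) ^ k := (Real.rpow_inv_natCast_pow h0 hk0).symm
      _ ≤ _ := pow_le_pow_left₀ (Real.rpow_nonneg h0 _) (Nat.lt_floor_add_one _).le k

lemma main_false (hA : ∀ a : A, a ≠ 0 → 1 ≤ ‖algebraMap A 𝕂 a‖)
    {Cs : ℝ} (hCs : 0 ≤ Cs) (hS : SiegelProp A 𝕂 Cs) {D : ℕ} (g : Fin D → 𝕂) (hg : ∃ j, g j ≠ 0)
    {t : ℕ} (x : Fin t → 𝕂) (k : ℕ) (htk : t < k) (δ s lam : ℕ → ℝ)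
    (hδ1 : ∀ n, 1 ≤ δ n) (hδm : Monotone δ) (hs1 : ∀ n, 1 ≤ s n) (hsm : Monotone s)
    (hl1 : ∀ n, 1 ≤ lam n) (hδ : Tendsto δ atTop atTop) (clam : ℝ)
    (hrat : Tendsto (fun n => lam (n + 1) / lam n) atTop (nhds clam))
    (hmono : ∃ N₀ : ℕ, MonotoneOn (fun n => lam n / (δ n ^ (k + 1) * s n)) (Set.Ici N₀))
    (C c₂ c₃ : ℝ) (hC : 1 ≤ C) (hc₂ : 0 < c₂) (hc₃ : 0 < c₃) (Z : ℕ → 𝕂)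
    (hZ : ∀ᶠ n in atTop, Z n ≠ 0 ∧ Rep A x g (Z n) ⌊C * δ n⌋₊ (Real.exp (C * s n)) ∧
      c₃ * lam n ≤ -Real.log ‖Z n‖ ∧ -Real.log ‖Z n‖ ≤ c₂ * lam n) : False := by
  obtain ⟨N₀, hmono⟩ := hmono
  have hrat2 : ∀ᶠ n in atTop, lam (n + 1) / lam n < clam + 1 :=
    hrat.eventually_lt_const (by linarith)
  obtain ⟨n₁, hn₁⟩ := eventually_atTop.1 (hZ.and hrat2)
  obtain ⟨r, hr, hr1, hr2⟩ := exists_root k (by omega) δ hδ1 hδ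
  set n₀ := max n₁ N₀ with hn₀
  set u : ℕ → ℝ := fun j => -Real.log ‖Z j‖ with hu
  set B : ℝ := max 1 (c₂ * (clam + 1) / c₃) with hB
  have hB1 : 1 ≤ B := le_max_left _ _
  have hpos : ∀ j, n₀ ≤ j → 0 < u j := by
    intro j hj
    have h1 := (hn₁ j ((le_max_left _ _).trans hj)).1.2.2.1
    have h2 := hl1 j
    exact lt_of_lt_of_le (by positivity) h1
  have hBu : ∀ j, n₀ ≤ j → u (j + 1) ≤ B * u j := by
    intro j hj
    have hj1 : n₁ ≤ j := (le_max_left _ _).trans hj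
    have h1 := (hn₁ j hj1).1.2.2.1
    have h2 := (hn₁ (j + 1) (by omega)).1.2.2.2
    have h3 := (hn₁ j hj1).2
    have hlj : 0 < lam j := by linarith [hl1 j]
    rw [div_lt_iff₀ hlj] at h3
    have h5 : 0 < clam + 1 := by
      have := hl1 (j + 1)
      by_contra hcon
      nlinarith
    calc u (j + 1) ≤ c₂ * lam (j + 1) := h2
      _ ≤ c₂ * ((clam + 1) * lam j) := by gcongr
      _ = (c₂ * (clam + 1) / c₃) * (c₃ * lam j) := by field_simp
      _ ≤ (c₂ * (clam + 1) / c₃) * u j := by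
        refine mul_le_mul_of_nonneg_left h1 (by positivity)
      _ ≤ B * u j := mul_le_mul_of_nonneg_right (le_max_right _ _) (hpos j hj).le
  set c : ℝ := lam N₀ / (δ N₀ ^ (k + 1) * s N₀) with hc
  have hcpos : 0 < c := by
    have h1 := hl1 N₀; have h2 := hδ1 N₀; have h3 := hs1 N₀
    positivity
  have hlam : ∀ n, N₀ ≤ n → c * (δ n ^ (k + 1) * s n) ≤ lam n := by
    intro n hn
    have h2 := hδ1 n; have h3 := hs1 n
    rw [← le_div_iff₀ (by positivity)]
    exact hmono (Set.mem_Ici.2 le_rfl) (Set.mem_Ici.2 hn) hn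
  set E : ℝ := 2 * (D * D) * (2 * C) ^ t with hE
  have hE0 : 0 ≤ E := by positivity
  set ρ : ℝ := 1 - 1 / B with hρ
  have hρ0 : 0 ≤ ρ := by
    have : 1 / B ≤ 1 := by rw [div_le_one (by linarith)]; exact hB1
    linarith
  have hρ1 : ρ < 1 := by
    have : 0 < 1 / B := by positivity
    linarith
  set a : ℕ := t + k * t with ha
  set E' : ℝ := E * 2 ^ (k * t) with hE'
  have hrR : Tendsto (fun n => ((r n : ℕ) : ℝ)) atTop atTop := tendsto_natCast_atTop_atTop.comp hr
  -- the asymptotic conditions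
  have e1 : ∀ᶠ n in atTop, u n₀ ≤ r n := hrR.eventually_ge_atTop _
  have e2 : ∀ᶠ n in atTop, 3 * E' * (((r n : ℕ) : ℝ) ^ a * ρ ^ r n) < 1 := by
    have h1 := (tendsto_pow_const_mul_const_pow_of_abs_lt_one a
      (by rw [abs_of_nonneg hρ0]; exact hρ1)).comp hr
    have h2 := h1.const_mul (3 * E')
    rw [mul_zero] at h2
    exact h2.eventually_lt_const one_pos
  have e3 : ∀ᶠ n in atTop,
      Cs * D * E' ^ 2 * (((r n : ℕ) : ℝ) ^ (2 * a) * Real.exp (-((r n : ℕ) : ℝ))) < 1 := by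
    have h1 := (Real.tendsto_pow_mul_exp_neg_atTop_nhds_zero (2 * a)).comp hrR
    have h2 := h1.const_mul (Cs * D * E' ^ 2)
    rw [mul_zero] at h2
    exact h2.eventually_lt_const one_pos
  have e4 : ∀ᶠ n in atTop, 6 * C * E / (c₃ * c) < δ n := hδ.eventually_gt_atTop _
  have e5 : ∀ᶠ n in atTop, 1 ≤ r n := hr.eventually_ge_atTop _
  obtain ⟨n, f1, f2, f3, f4, f5, hn⟩ :=
    (e1.and (e2.and (e3.and (e4.and (e5.and (eventually_ge_atTop n₀)))))).exists
  have hδn := hδ1 n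
  have hsn := hs1 n
  have f5' : (1 : ℝ) ≤ r n := by exact_mod_cast f5
  set K : ℕ := 2 * (D * D * (r n * ⌊C * δ n⌋₊ + 1) ^ t) with hK
  have hKle : (K : ℝ) ≤ E * (((r n : ℕ) : ℝ) ^ t * δ n ^ t) := by
    have h1 : ((⌊C * δ n⌋₊ : ℕ) : ℝ) ≤ C * δ n := Nat.floor_le (by positivity)
    have h2 : ((r n : ℕ) : ℝ) * (⌊C * δ n⌋₊ : ℕ) + 1 ≤ 2 * C * (r n * δ n) := by
      have h3 : ((r n : ℕ) : ℝ) * (⌊C * δ n⌋₊ : ℕ) ≤ r n * (C * δ n) := by gcongr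
      have h4 : (1 : ℝ) ≤ r n * (C * δ n) :=
        one_le_mul_of_one_le_of_one_le f5' (one_le_mul_of_one_le_of_one_le hC hδn)
      linarith
    rw [hK]
    push_cast
    calc (2 : ℝ) * (D * D * (r n * (⌊C * δ n⌋₊ : ℕ) + 1) ^ t)
        ≤ 2 * (D * D * (2 * C * (r n * δ n)) ^ t) := by gcongr
      _ = _ := by rw [hE, mul_pow (2 * C), mul_pow (r n : ℝ)]; ring
  have hKle2 : (K : ℝ) ≤ E' * ((r n : ℕ) : ℝ) ^ a := by
    refine hKle.trans ?_
    have h1 : δ n ≤ (2 * ((r n : ℕ) : ℝ)) ^ k :=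
      (hr2 n).trans (pow_le_pow_left₀ (by positivity) (by linarith) k)
    calc E * (((r n : ℕ) : ℝ) ^ t * δ n ^ t)
        ≤ E * (((r n : ℕ) : ℝ) ^ t * ((2 * ((r n : ℕ) : ℝ)) ^ k) ^ t) := by gcongr
      _ = _ := by rw [hE', ha, ← pow_mul, mul_pow, pow_add]; ring
  refine step_false hA hS g hg x C (δ n) (s n) B hC hsn hB1 Z n₀ n hn ?_ ?_ u hu hpos hBu
    (r n) K (6 * C * r n * s n) f5 hK rfl ?_ ?_ ?_ ?_
  · intro j hj hjn
    have h1 := (hn₁ j ((le_max_left _ _).trans hj)).1.2.1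
    have h2 := hδm hjn.le
    have h3 := hsm hjn.le
    exact h1.mono (Nat.floor_le_floor (by gcongr)) (Real.exp_le_exp.2 (by gcongr))
  · intro j hj
    exact (hn₁ j ((le_max_left _ _).trans hj)).1.1
  · have h1 : 1 ≤ C * s n := one_le_mul_of_one_le_of_one_le hC hsn
    nlinarith
  · calc 3 * (K : ℝ) * ρ ^ r n ≤ 3 * (E' * ((r n : ℕ) : ℝ) ^ a) * ρ ^ r n := by gcongr
      _ = 3 * E' * (((r n : ℕ) : ℝ) ^ a * ρ ^ r n) := by ring
      _ ≤ 1 := f2.le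
  · calc Cs * D * (K : ℝ) ^ 2 ≤ Cs * D * (E' * ((r n : ℕ) : ℝ) ^ a) ^ 2 := by gcongr
      _ = Cs * D * E' ^ 2 * (((r n : ℕ) : ℝ) ^ (2 * a) * Real.exp (-((r n : ℕ) : ℝ))) *
          Real.exp (r n : ℕ) := by
        rw [Real.exp_neg]
        field_simp
        ring
      _ ≤ 1 * Real.exp (r n : ℕ) := by gcongr
      _ = _ := one_mul _
  · have h1 := (hn₁ n ((le_max_left _ _).trans hn)).1.2.2.1
    have h2 := hlam n ((le_max_right _ _).trans hn)
    rw [div_lt_iff₀ (by positivity)] at f4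
    have h3 : ((r n : ℕ) : ℝ) ^ (t + 1) ≤ δ n :=
      (pow_le_pow_right₀ f5' (by omega)).trans (hr1 n)
    have h4 : δ n ^ (t + 1) ≤ δ n ^ k := pow_le_pow_right₀ hδn (by omega)
    calc (K : ℝ) * (6 * C * r n * s n)
        ≤ (E * (((r n : ℕ) : ℝ) ^ t * δ n ^ t)) * (6 * C * r n * s n) := by gcongr
      _ = 6 * C * E * ((((r n : ℕ) : ℝ) ^ (t + 1)) * δ n ^ t * s n) := by ring
      _ ≤ 6 * C * E * (δ n * δ n ^ t * s n) := by gcongr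
      _ = 6 * C * E * (δ n ^ (t + 1) * s n) := by ring
      _ ≤ 6 * C * E * (δ n ^ k * s n) := by gcongr
      _ < δ n * (c₃ * c) * (δ n ^ k * s n) := by gcongr
      _ = c₃ * (c * (δ n ^ (k + 1) * s n)) := by ring
      _ ≤ c₃ * lam n := by gcongr
      _ ≤ u n := h1

end
end PhilC

namespace PhilC

section
attribute [local instance] Matrix.seminormedAddCommGroup

lemma siegel_int : SiegelProp ℤ ℂ 1 := by
  intro μ κ _ _ hcard hκ a H hH ha
  rw [one_mul]
  have hκ1 : (1 : ℝ) ≤ Fintype.card κ := by exact_mod_cast hκ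
  have hKH : 1 ≤ (Fintype.card κ : ℝ) * H := one_le_mul_of_one_le_of_one_le hκ1 hH
  rcases Nat.eq_zero_or_pos (Fintype.card μ) with h0 | h0
  · have := Fintype.card_eq_zero_iff.1 h0
    have hne : Nonempty κ := Fintype.card_pos_iff.1 hκ
    refine ⟨fun _ => 1, ?_, fun i => isEmptyElim i, fun j => by simpa using hKH⟩
    intro h
    have := congrFun h hne.some
    simp at this
  · obtain ⟨p, p0, p1, p2⟩ := Int.Matrix.exists_ne_zero_int_vec_norm_le a (by omega) h0
    refine ⟨p, p0, fun i => congrFun p1 i, fun j => ?_⟩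
    have h1 : ‖a‖ ≤ H := by
      rw [Matrix.norm_le_iff (by linarith)]
      intro i j
      have := ha i j
      simpa [Int.norm_eq_abs] using this
    have h2 : ‖algebraMap ℤ ℂ (p j)‖ = ‖p j‖ := by simp [Int.norm_eq_abs]
    have h4 : (1 : ℝ) ≤ max 1 ‖a‖ := le_max_left _ _
    have h6 : (2 : ℝ) * Fintype.card μ ≤ Fintype.card κ := by exact_mod_cast hcard
    have h7 : (1 : ℝ) ≤ Fintype.card μ := by exact_mod_cast h0
    rw [h2]
    calc ‖p j‖ ≤ ‖p‖ := norm_le_pi_norm p j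
      _ ≤ _ := p2
      _ ≤ (Fintype.card κ * max 1 ‖a‖) ^ (1 : ℝ) := by
        refine Real.rpow_le_rpow_of_exponent_le (one_le_mul_of_one_le_of_one_le hκ1 h4) ?_
        rw [div_le_one (by linarith)]; linarith
      _ = Fintype.card κ * max 1 ‖a‖ := Real.rpow_one _
      _ ≤ Fintype.card κ * H := by gcongr; exact max_le hH h1

end

lemma siegel_poly {F : Type*} [Field F] {𝕂 : Type*} [NormedField 𝕂] [Algebra (Polynomial F) 𝕂]
    (q : ℝ) (hq : 1 ≤ q)
    (hn : ∀ a : Polynomial F, a ≠ 0 → ‖algebraMap (Polynomial F) 𝕂 a‖ = q ^ a.natDegree) :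
    SiegelProp (Polynomial F) 𝕂 1 := by
  classical
  intro μ κ _ _ hcard hκ a H hH ha
  rw [one_mul]
  have hκ1 : (1 : ℝ) ≤ Fintype.card κ := by exact_mod_cast hκ
  obtain ⟨d, hd, hdH⟩ : ∃ d : ℕ, (∀ i j, (a i j).natDegree ≤ d) ∧ q ^ d ≤ H := by
    let S : Finset (μ × κ) := Finset.univ
    refine ⟨S.sup fun x => (a x.1 x.2).natDegree, fun i j =>
      Finset.le_sup (f := fun x : μ × κ => (a x.1 x.2).natDegree) (Finset.mem_univ (i, j)), ?_⟩
    refine Finset.sup_induction (p := fun d : ℕ => q ^ d ≤ H) (by simpa using hH) ?_ ?_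
    · intro x hx y hy
      rcases le_total x y with h | h
      · simpa [h] using hy
      · simpa [h] using hx
    · intro x _
      by_cases h : a x.1 x.2 = 0
      · simpa [h] using hH
      · rw [← hn _ h]; exact ha _ _
  let P : (Fin (d + 1) → F) →ₗ[F] Polynomial F :=
    ∑ e : Fin (d + 1), (Polynomial.monomial (e : ℕ)).comp (LinearMap.proj e)
  have hP : ∀ v, P v = ∑ e : Fin (d + 1), Polynomial.monomial (e : ℕ) (v e) := by
    intro v; simp [P]
  have hPd : ∀ v, (P v).natDegree ≤ d := by
    intro v
    rw [hP]
    refine Polynomial.natDegree_sum_le_of_forall_le _ _ fun e _ => ?_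
    exact (Polynomial.natDegree_monomial_le _).trans (by have := e.2; omega)
  have hPc : ∀ v (e : Fin (d + 1)), (P v).coeff e = v e := by
    intro v e
    rw [hP, Polynomial.finsetSum_coeff]
    simp [Polynomial.coeff_monomial, Fin.val_inj]
  let Φ : (κ → Fin (d + 1) → F) →ₗ[F] (μ → Fin (2 * d + 1) → F) :=
    LinearMap.pi fun i => LinearMap.pi fun c => (Polynomial.lcoeff F (c : ℕ)).comp
      (∑ j, (LinearMap.mulLeft F (a i j)).comp (P.comp (LinearMap.proj j)))
  have hΦ : ∀ v i c, Φ v i c = (∑ j, a i j * P (v j)).coeff c := by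
    intro v i c; simp [Φ]
  have hker : LinearMap.ker Φ ≠ ⊥ := by
    refine LinearMap.ker_ne_bot_of_finrank_lt ?_
    simp only [Module.finrank_pi_fintype, Finset.sum_const,
      Finset.card_univ, smul_eq_mul, Module.finrank_self, mul_one, Fintype.card_fin]
    nlinarith
  obtain ⟨v, hv, hv0⟩ := Submodule.exists_mem_ne_zero_of_ne_bot hker
  refine ⟨fun j => P (v j), ?_, ?_, ?_⟩
  · intro h
    apply hv0
    ext j e
    rw [← hPc (v j) e, show P (v j) = 0 from congrFun h j]; simp
  · intro i
    ext c
    by_cases hc : c < 2 * d + 1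
    · rw [show c = ((⟨c, hc⟩ : Fin (2 * d + 1)) : ℕ) from rfl, ← hΦ, LinearMap.mem_ker.1 hv]
      simp
    · rw [Polynomial.coeff_eq_zero_of_natDegree_lt, Polynomial.coeff_zero]
      refine lt_of_le_of_lt (Polynomial.natDegree_sum_le_of_forall_le _ (n := 2 * d) _ fun j _ => ?_)
        (by omega)
      refine Polynomial.natDegree_mul_le.trans ?_
      have h1 := hd i j
      have h2 := hPd (v j)
      exact (add_le_add h1 h2).trans (by omega)
  · intro j
    have h1 : ‖algebraMap (Polynomial F) 𝕂 (P (v j))‖ ≤ q ^ d := by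
      by_cases h : P (v j) = 0
      · rw [h, map_zero, norm_zero]; positivity
      · rw [hn _ h]; exact pow_le_pow_right₀ hq (hPd _)
    nlinarith

end PhilC

namespace PhilC

lemma isIntegral_of_subring (A : Type*) {𝒦 𝕂 : Type*} [CommRing A] [Field 𝒦] [Field 𝕂]
    [Algebra A 𝒦] [Algebra 𝒦 𝕂] [Algebra A 𝕂] [IsScalarTower A 𝒦 𝕂]
    (ℒ : IntermediateField 𝒦 𝕂) (c : ℒ)
    (h : IsIntegralOverSubring 𝒦 (algebraMap A 𝒦).range ℒ c) : IsIntegral A (c : 𝕂) := by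
  obtain ⟨p, hp, hc, h0⟩ := h
  obtain ⟨P, hP, -, hPm⟩ := Polynomial.lifts_and_natDegree_eq_and_monic
    (f := algebraMap A 𝒦) ((Polynomial.lifts_iff_coeff_lifts p).2 fun i => by simpa using hc i) hp
  refine ⟨P, hPm, ?_⟩
  have h1 : Polynomial.aeval (c : 𝕂) p = 0 := by
    have := congrArg (algebraMap ℒ 𝕂) h0
    rw [← Polynomial.aeval_algebraMap_apply, map_zero] at this
    exact this
  rw [← hP, Polynomial.aeval_map_algebraMap] at h1
  exact h1

theorem generic (A 𝒦 𝕂 : Type) [CommRing A] [IsDomain A] [IsIntegrallyClosed A] [Field 𝒦]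
    [NormedField 𝕂] [IsAlgClosed 𝕂] [Algebra A 𝒦] [IsFractionRing A 𝒦] [Algebra 𝒦 𝕂] [Algebra A 𝕂]
    [IsScalarTower A 𝒦 𝕂] (ℒ : IntermediateField 𝒦 𝕂) [FiniteDimensional 𝒦 ℒ]
    (hA : ∀ a : A, a ≠ 0 → 1 ≤ ‖algebraMap A 𝕂 a‖) (hS : SiegelProp A 𝕂 1) :
    PhilipponCriterion 𝒦 𝕂 (algebraMap A 𝒦).range ℒ := by
  intro m k hk hkm α δ s lam c₂ c₃ cδ cσ clam hc₂ hc₃ _ _ _ hδ1 hδm hs1 hsm hl1 hlm hδ _ _ hrat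
    hδs hmono _ Q hQint hQdeg hQh hQ
  have hinj : Function.Injective (algebraMap A 𝕂) := by
    rw [IsScalarTower.algebraMap_eq A 𝒦 𝕂]
    exact (algebraMap 𝒦 𝕂).injective.comp (IsFractionRing.injective A 𝒦)
  have : FaithfulSMul A 𝕂 := (faithfulSMul_iff_algebraMap_injective A 𝕂).2 hinj
  obtain ⟨b, hb1, hb2, hb3⟩ := exists_trans_basis (A := A) α
  have hbfin : b.Finite := (Set.finite_range α).subset hb1
  have : Fintype b := hbfin.fintype
  have hbL : AlgebraicIndependent ℒ ((↑) : b → 𝕂) := by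
    have : Algebra.IsAlgebraic A 𝒦 := 
      (IsFractionRing.comap_isAlgebraic_iff (A := A) (K := 𝒦)).2 inferInstance
    have h1 : AlgebraicIndependent 𝒦 ((↑) : b → 𝕂) := hb2.extendScalars 𝒦
    exact h1.extendScalars ℒ
  have hle : Cardinal.mk b ≤ genTrdeg ℒ 𝕂 (Set.range α) := by
    refine le_ciSup (f := fun s : { s : Set 𝕂 //
      s ⊆ (IntermediateField.adjoin ℒ (Set.range α) : Set 𝕂) ∧
        AlgebraicIndependent ℒ ((↑) : s → 𝕂) } => Cardinal.mk s.1) (Cardinal.bddAbove_of_small)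
      ⟨b, hb1.trans (IntermediateField.subset_adjoin ℒ _), hbL⟩
  rw [Cardinal.mk_fintype] at hle
  refine le_trans ?_ hle
  rw [Nat.cast_le]
  by_contra hlt
  rw [not_le] at hlt
  let x : Fin (Fintype.card b) → 𝕂 := fun i => ((Fintype.equivFin b).symm i : 𝕂)
  have hx : Set.range x = Set.range ((↑) : b → 𝕂) :=
    (Fintype.equivFin b).symm.surjective.range_comp _
  obtain ⟨D, g, q, C, hq, hC, hg, hZ⟩ := exists_Z A 𝒦 𝕂 ℒ α x (by rw [hx]; exact hb3)
  have hq' : (1 : ℝ) ≤ q := by exact_mod_cast hq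
  -- growth of `lam`
  have hlam : ∀ᶠ n in atTop, C * δ n ≤ c₃ / 2 * lam n := by
    obtain ⟨N₀, hmono⟩ := hmono
    set c : ℝ := lam N₀ / (δ N₀ ^ (k + 1) * s N₀) with hc
    have hcpos : 0 < c := by
      have h1 := hl1 N₀
      have h2 := hδ1 N₀
      have h3 := hs1 N₀
      positivity
    filter_upwards [eventually_ge_atTop N₀, hδ.eventually_ge_atTop (C / (c₃ / 2 * c))] with n hn hn2
    have h2 := hδ1 n
    have h3 := hs1 n
    have h4 : c * (δ n ^ (k + 1) * s n) ≤ lam n := by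
      rw [← le_div_iff₀ (by positivity)]
      exact hmono (Set.mem_Ici.2 le_rfl) (Set.mem_Ici.2 hn) hn
    rw [div_le_iff₀ (by positivity)] at hn2
    have h5 : δ n ^ 2 ≤ δ n ^ (k + 1) := pow_le_pow_right₀ h2 (by omega)
    calc C * δ n ≤ (δ n * (c₃ / 2 * c)) * δ n := by gcongr
      _ = c₃ / 2 * (c * (δ n ^ 2 * 1)) := by ring
      _ ≤ c₃ / 2 * (c * (δ n ^ (k + 1) * s n)) := by gcongr
      _ ≤ _ := by gcongr
  have hex : ∀ n, ∃ Z : 𝕂, (δ n ≤ s n →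
      MvPolynomial.eval α (MvPolynomial.map (algebraMap ℒ 𝕂) (Q n)) ≠ 0 →
      Z ≠ 0 ∧ Rep A x g Z ⌊C * δ n⌋₊ (Real.exp (C * s n)) ∧
          |Real.log ‖Z‖ - q *
            Real.log ‖MvPolynomial.eval α (MvPolynomial.map (algebraMap ℒ 𝕂) (Q n))‖| ≤
            C * δ n) := by
    intro n
    by_cases h : δ n ≤ s n ∧ MvPolynomial.eval α (MvPolynomial.map (algebraMap ℒ 𝕂) (Q n)) ≠ 0
    · obtain ⟨Z, h1⟩ := hZ (Q n) (δ n) (s n) (hδ1 n) h.1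
        (fun mo => isIntegral_of_subring A ℒ _ (hQint n mo)) (hQdeg n) (hQh n) h.2
      exact ⟨Z, fun _ _ => h1⟩
    · exact ⟨0, fun h1 h2 => absurd ⟨h1, h2⟩ h⟩
  choose Z hZ2 using hex
  refine main_false hA zero_le_one hS g hg x k hlt δ s lam hδ1 hδm hs1 hsm hl1 hδ clam hrat hmono
    C (q * c₂ + c₃) (c₃ / 2) hC (by positivity) (by positivity) Z ?_
  filter_upwards [hδs, hlam, hQ] with n h1 h2 h3
  have hln := hl1 n
  have hne : MvPolynomial.eval α (MvPolynomial.map (algebraMap ℒ 𝕂) (Q n)) ≠ 0 := by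
    intro h
    rw [h, norm_zero, Real.log_zero] at h3
    have : 0 < c₃ * lam n := by positivity
    linarith [h3.2]
  obtain ⟨a1, a2, a3⟩ := hZ2 n h1 hne
  rw [abs_le] at a3
  have b1 : 0 < c₃ * lam n := by positivity
  have b2 : (q : ℝ) * (c₃ * lam n) ≤ q *
      -Real.log ‖MvPolynomial.eval α (MvPolynomial.map (algebraMap ℒ 𝕂) (Q n))‖ :=
    mul_le_mul_of_nonneg_left (by linarith [h3.2]) (by linarith)
  have b3 : (q : ℝ) *
      -Real.log ‖MvPolynomial.eval α (MvPolynomial.map (algebraMap ℒ 𝕂) (Q n))‖ ≤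
      q * (c₂ * lam n) :=
    mul_le_mul_of_nonneg_left (by linarith [h3.1]) (by linarith)
  have b4 : c₃ * lam n ≤ q * (c₃ * lam n) := le_mul_of_one_le_left b1.le hq'
  exact ⟨a1, a2, by linarith [a3.2], by linarith [a3.1]⟩

theorem case_int (L : IntermediateField ℚ ℂ) (hL : FiniteDimensional ℚ L) :
    PhilipponCriterion ℚ ℂ (Int.castRingHom ℚ).range L := by
  have := generic ℤ ℚ ℂ L (fun a ha => by
    have : (1 : ℝ) ≤ |(a : ℝ)| := by exact_mod_cast Int.one_le_abs ha
    simpa using this) siegel_int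
  exact this

theorem case_poly (Fq : Type) [Field Fq] [Fintype Fq]
    (C : Type) [NormedField C] [IsAlgClosed C] [Algebra (RatFunc Fq) C]
    (hn : ∀ r : RatFunc Fq, r ≠ 0 →
        ‖algebraMap (RatFunc Fq) C r‖ = (Fintype.card Fq : ℝ) ^ r.intDegree)
    (ℒ : IntermediateField (RatFunc Fq) C) (hL : FiniteDimensional (RatFunc Fq) ℒ) :
    PhilipponCriterion (RatFunc Fq) C
          (algebraMap (Polynomial Fq) (RatFunc Fq)).range ℒ := by
  let _ : Algebra (Polynomial Fq) C :=
    ((algebraMap (RatFunc Fq) C).comp (algebraMap (Polynomial Fq) (RatFunc Fq))).toAlgebra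
  have : IsScalarTower (Polynomial Fq) (RatFunc Fq) C := IsScalarTower.of_algebraMap_eq fun _ => rfl
  have hq : (1 : ℝ) ≤ Fintype.card Fq := by exact_mod_cast Fintype.card_pos
  have hn2 : ∀ a : Polynomial Fq, a ≠ 0 →
      ‖algebraMap (Polynomial Fq) C a‖ = (Fintype.card Fq : ℝ) ^ a.natDegree := by
    intro a ha
    rw [IsScalarTower.algebraMap_apply (Polynomial Fq) (RatFunc Fq) C, hn _ (by simpa using ha),
      RatFunc.intDegree_polynomial, zpow_natCast]
  exact generic (Polynomial Fq) (RatFunc Fq) C ℒ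
    (fun a ha => by rw [hn2 a ha]; exact one_le_pow₀ hq) (siegel_poly _ hq hn2)

end PhilC

/-- **Philippon's criterion of algebraic independence.**  It holds in both of
the following situations:
(i) `𝕂 = ℂ`, `𝒦 = ℚ`, `𝒜 = ℤ`, and `ℒ ⊂ ℂ` a number field, with the usual
absolute value;
(ii) `𝕂 = C` the completion of an algebraic closure of `𝔽_q((1/θ))`
(modelled as a complete algebraically closed normed field extension of
`K = 𝔽_q(θ)` with `‖a‖ = q^{deg_θ a}` on `K`), `𝒦 = K`, `𝒜 = A = 𝔽_q[θ]`, and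
`ℒ ⊂ C` a finite extension of `K`. -/
theorem stmt_9 :
    (∀ L : IntermediateField ℚ ℂ, FiniteDimensional ℚ L →
      PhilipponCriterion ℚ ℂ (Int.castRingHom ℚ).range L) ∧
    (∀ (Fq : Type) [Field Fq] [Fintype Fq]
        (C : Type) [NormedField C] [CompleteSpace C] [IsAlgClosed C]
        [Algebra (RatFunc Fq) C],
      (∀ r : RatFunc Fq, r ≠ 0 →
        ‖algebraMap (RatFunc Fq) C r‖ = (Fintype.card Fq : ℝ) ^ r.intDegree) →
      ∀ ℒ : IntermediateField (RatFunc Fq) C, FiniteDimensional (RatFunc Fq) ℒ →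
        PhilipponCriterion (RatFunc Fq) C
          (algebraMap (Polynomial Fq) (RatFunc Fq)).range ℒ) := by
  exact ⟨fun L hL => PhilC.case_int L hL, fun Fq _ _ C _ _ _ _ hn ℒ hL =>
    PhilC.case_poly Fq C hn ℒ hL⟩
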